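/- Let f : 𝔻 → ℝ be a minimal graph over the open unit disk. Then the Gaussian curvature at the origin satisfies |K(0,0)| < π²/2, i.e. |f_uu(0,0) f_vv(0,0) − f_uv(0,0)²| / (1 + f_u(0,0)² + f_v(0,0)²)² < π²/2. -/

import Mathlib

open Real

/-- The open unit disk in `ℝ × ℝ`. -/
def unitDisk : Set (ℝ × ℝ) := {p : ℝ × ℝ | p.1 ^ 2 + p.2 ^ 2 < 1}

/-- Partial derivative with respect to the first coordinate `u`. -/
noncomputable def pu (f : ℝ × ℝ → ℝ) (p : ℝ × ℝ) : ℝ :=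
  deriv (fun u : ℝ => f (u, p.2)) p.1

/-- Partial derivative with respect to the second coordinate `v`. -/
noncomputable def pv (f : ℝ × ℝ → ℝ) (p : ℝ × ℝ) : ℝ :=
  deriv (fun v : ℝ => f (p.1, v)) p.2

/-- `f : 𝔻 → ℝ` is a minimal graph over the open unit disk: it is `C²` there and
    satisfies the minimal surface equation. -/
def IsMinimalGraph (f : ℝ × ℝ → ℝ) : Prop :=
  ContDiffOn ℝ 2 f unitDisk ∧
    ∀ p ∈ unitDisk,
      (1 + (pv f p) ^ 2) * pu (pu f) p
        - 2 * pu f p * pv f p * pv (pu f) p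
        + (1 + (pu f p) ^ 2) * pv (pv f) p = 0

section CauchyTransform

open MeasureTheory Metric Set Filter Topology Complex

/-- The Wirtinger operator `∂/∂z̄` applied to a real-linear map. -/
noncomputable def dbar (L : ℂ →L[ℝ] ℂ) : ℂ := (L 1 + I * L I) / 2

/-- The Cauchy kernel `1/(πz)`, the fundamental solution of `∂/∂z̄`. -/
noncomputable def cauchyKernel (z : ℂ) : ℂ := ((π : ℂ) * z)⁻¹

/-- The Cauchy transform, i.e. convolution with the Cauchy kernel. -/
noncomputable def cauchyTransform (g : ℂ → ℂ) (u : ℂ) : ℂ := ∫ z, cauchyKernel z * g (u - z)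

lemma norm_cauchyKernel (z : ℂ) : ‖cauchyKernel z‖ = π⁻¹ * ‖z‖⁻¹ := by
  simp [cauchyKernel, abs_of_pos pi_pos, mul_comm]

lemma measurable_cauchyKernel : Measurable cauchyKernel := by
  unfold cauchyKernel; fun_prop

lemma locallyIntegrable_cauchyKernel : LocallyIntegrable cauchyKernel := by
  refine locallyIntegrable_of_norm_le_rpow (C := π⁻¹) (α := 1) ?_ ?_ ?_
    measurable_cauchyKernel.aestronglyMeasurable
  · simp [Complex.finrank_real_complex]
  · simp [Complex.finrank_real_complex]
  · filter_upwards with z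
    rw [norm_cauchyKernel, Real.rpow_neg_one]

lemma dbar_eq_polar (L : ℂ →L[ℝ] ℂ) (θ : ℝ) :
    (Complex.cos θ + Complex.sin θ * I)⁻¹ * dbar L =
      (L (Complex.cos θ + Complex.sin θ * I) + I * L ((Complex.cos θ + Complex.sin θ * I) * I)) / 2 := by
  have h1 : L (Complex.cos θ + Complex.sin θ * I) = Complex.cos θ * L 1 + Complex.sin θ * L I := by
    have : (Complex.cos θ + Complex.sin θ * I) = (Real.cos θ) • (1 : ℂ) + (Real.sin θ) • I := by simp
    rw [this, map_add, map_smul, map_smul]; simp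
  have h2 : L ((Complex.cos θ + Complex.sin θ * I) * I) =
      - Complex.sin θ * L 1 + Complex.cos θ * L I := by
    have : ((Complex.cos θ + Complex.sin θ * I) * I) =
        (-Real.sin θ) • (1 : ℂ) + (Real.cos θ) • I := by
      simp; linear_combination Complex.sin θ * I_sq
    rw [this, map_add, map_smul, map_smul]; simp
  have h3 : (Complex.cos θ + Complex.sin θ * I)⁻¹ = Complex.cos θ - Complex.sin θ * I := by
    apply inv_eq_of_mul_eq_one_right
    linear_combination Complex.cos_sq_add_sin_sq (θ : ℂ) - Complex.sin θ ^ 2 * I_sq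
  rw [h1, h2, h3, dbar]
  linear_combination - Complex.sin θ * L I / 2 * I_sq

lemma hasDerivAt_radial {ψ : ℂ → ℂ} (hψ : Differentiable ℝ ψ) (u e : ℂ) (r : ℝ) :
    HasDerivAt (fun r : ℝ => ψ (u - r * e)) (-(fderiv ℝ ψ (u - r * e) e)) r := by
  have h := (hψ (u - r * e)).hasFDerivAt.comp_hasDerivAt r
    (((Complex.ofRealCLM.hasDerivAt (x := r)).mul_const e).const_sub u)
  exact h.congr_deriv (by simp)

lemma hasDerivAt_angular {ψ : ℂ → ℂ} (hψ : Differentiable ℝ ψ) (u : ℂ) (r θ : ℝ) :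
    HasDerivAt (fun θ : ℝ => ψ (u - r * (Complex.cos θ + Complex.sin θ * I)))
      (-(r * (fderiv ℝ ψ (u - r * (Complex.cos θ + Complex.sin θ * I))
        ((Complex.cos θ + Complex.sin θ * I) * I)))) θ := by
  have hc : HasDerivAt (fun θ : ℝ => Complex.cos θ) (-Complex.sin θ) θ :=
    (Complex.hasDerivAt_cos θ).comp_ofReal
  have hs : HasDerivAt (fun θ : ℝ => Complex.sin θ) (Complex.cos θ) θ :=
    (Complex.hasDerivAt_sin θ).comp_ofReal
  have h := (hψ (u - r * (Complex.cos θ + Complex.sin θ * I))).hasFDerivAt.comp_hasDerivAt θ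
    (((hc.add (hs.mul_const I)).const_mul (r : ℂ)).const_sub u)
  refine h.congr_deriv ?_
  have : -(↑r * (-Complex.sin θ + Complex.cos θ * I)) =
      (-r) • ((Complex.cos θ + Complex.sin θ * I) * I) := by
    rw [real_smul, ofReal_neg]; linear_combination Complex.sin θ * r * I_sq
  rw [this, map_smul, real_smul, ofReal_neg, neg_mul]

/-- The Cauchy–Pompeiu formula for compactly supported functions. -/
theorem cauchyTransform_dbar {ψ : ℂ → ℂ} (hψ : ContDiff ℝ 1 ψ) (hc : HasCompactSupport ψ) (u : ℂ) :
    cauchyTransform (fun z => dbar (fderiv ℝ ψ z)) u = ψ u := by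
  have hd : Differentiable ℝ ψ := hψ.differentiable one_ne_zero
  have hcont : Continuous (fderiv ℝ ψ) := hψ.continuous_fderiv one_ne_zero
  have hc' : HasCompactSupport (fderiv ℝ ψ) := hc.fderiv ℝ
  obtain ⟨R, hR0, hR⟩ : ∃ R : ℝ, 0 < R ∧ ∀ r : ℝ, R ≤ r → ∀ θ : ℝ,
      ψ (u - r * (Complex.cos θ + Complex.sin θ * I)) = 0 ∧
      fderiv ℝ ψ (u - r * (Complex.cos θ + Complex.sin θ * I)) = 0 := by
    obtain ⟨R, hR⟩ := hc.isCompact.isBounded.subset_closedBall u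
    refine ⟨|R| + 1, by positivity, fun r hr θ => ?_⟩
    have : u - r * (Complex.cos θ + Complex.sin θ * I) ∉ tsupport ψ := by
      intro h
      have h1 := hR h
      have h2 : ‖Complex.cos θ + Complex.sin θ * I‖ = 1 := Complex.norm_cos_add_sin_mul_I θ
      rw [mem_closedBall, dist_eq_norm] at h1
      simp only [sub_sub_cancel_left, norm_neg, norm_mul, h2, norm_real, Real.norm_eq_abs] at h1
      have := le_abs_self r; have := le_abs_self R; linarith
    exact ⟨image_eq_zero_of_notMem_tsupport this,
      image_eq_zero_of_notMem_tsupport fun h => this (tsupport_fderiv_subset ℝ h)⟩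
  let P : ℝ × ℝ → ℂ := fun p => fderiv ℝ ψ (u - p.1 * (Complex.cos p.2 + Complex.sin p.2 * I))
      (Complex.cos p.2 + Complex.sin p.2 * I)
  let Q : ℝ × ℝ → ℂ := fun p => fderiv ℝ ψ (u - p.1 * (Complex.cos p.2 + Complex.sin p.2 * I))
      ((Complex.cos p.2 + Complex.sin p.2 * I) * I)
  have hPc : Continuous P := by
    refine Continuous.clm_apply (hcont.comp ?_) ?_ <;> fun_prop
  have hQc : Continuous Q := by
    refine Continuous.clm_apply (hcont.comp ?_) ?_ <;> fun_prop
  have hG_int : ∀ G : ℝ × ℝ → ℂ, Continuous G → (∀ p, R ≤ p.1 → G p = 0) →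
      IntegrableOn G (Ioi (0 : ℝ) ×ˢ Ioo (-π) π) := by
    intro G hG h0
    have h1 : IntegrableOn G (Icc 0 R ×ˢ Icc (-π) π) :=
      hG.continuousOn.integrableOn_compact (isCompact_Icc.prod isCompact_Icc)
    refine (h1.of_forall_sdiff_eq_zero (t := Ioi (0 : ℝ) ×ˢ Ioo (-π) π)
      (measurableSet_Ioi.prod measurableSet_Ioo) ?_)
    rintro p ⟨⟨hp1, hp2⟩, hp3⟩
    apply h0
    by_contra! h
    exact hp3 ⟨⟨le_of_lt hp1, h.le⟩, Ioo_subset_Icc_self hp2⟩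
  have hPi := hG_int P hPc fun p hp => by simp [P, (hR p.1 hp p.2).2]
  have hQi := hG_int Q hQc fun p hp => by simp [Q, (hR p.1 hp p.2).2]
  have hI1 : ∫ p in Ioi (0 : ℝ) ×ˢ Ioo (-π) π, P p = 2 * π * ψ u := by
    have hvol : (volume : Measure (ℝ × ℝ)) = (volume : Measure ℝ).prod volume := rfl
    rw [hvol] at hPi ⊢
    rw [← Measure.prod_restrict] 
    rw [IntegrableOn, ← Measure.prod_restrict] at hPi
    rw [integral_prod_symm _ hPi]
    have : ∀ θ : ℝ, ∫ r in Ioi (0 : ℝ), P (r, θ) = ψ u := by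
      intro θ
      have hd1 := fun r : ℝ => (hasDerivAt_radial hd u (Complex.cos θ + Complex.sin θ * I) r).neg
      have := integral_Ioi_of_hasDerivAt_of_tendsto (a := 0) (m := 0)
        (hd1 0).continuousAt.continuousWithinAt (fun r _ => hd1 r) ?_ ?_
      · simpa [P] using this
      · have h1 : Continuous fun r : ℝ => P (r, θ) := hPc.comp (by fun_prop)
        have h2 : IntegrableOn (fun r : ℝ => P (r, θ)) (Icc 0 R) :=
          h1.continuousOn.integrableOn_compact isCompact_Icc
        have h3 := h2.of_forall_sdiff_eq_zero (t := Ioi (0 : ℝ)) measurableSet_Ioi fun r hr => by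
          have : R ≤ r := by
            by_contra! h
            exact hr.2 ⟨le_of_lt hr.1, h.le⟩
          simp [P, (hR r this θ).2]
        simpa [P] using h3
      · refine tendsto_const_nhds.congr' ?_
        filter_upwards [eventually_ge_atTop R] with r hr
        simp [(hR r hr θ).1]
    simp_rw [this]
    simp [Real.pi_pos.le]
    left; ring
  have hI2 : ∫ p in Ioi (0 : ℝ) ×ˢ Ioo (-π) π, Q p = 0 := by
    have hvol : (volume : Measure (ℝ × ℝ)) = (volume : Measure ℝ).prod volume := rfl
    rw [hvol] at hQi ⊢
    rw [setIntegral_prod _ hQi]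
    rw [setIntegral_congr_fun (g := fun _ => (0 : ℂ)) measurableSet_Ioi]
    · simp
    intro r hr
    have hr : 0 < r := hr
    have h1 : ∫ θ in (-π)..π, -(r * Q (r, θ)) = 0 := by
      rw [intervalIntegral.integral_eq_sub_of_hasDerivAt
        (fun θ _ => hasDerivAt_angular hd u r θ)]
      · simp
      · apply Continuous.intervalIntegrable
        have : Continuous fun θ : ℝ => Q (r, θ) := hQc.comp (by fun_prop)
        exact (continuous_const.mul this).neg
    rw [intervalIntegral.integral_neg, intervalIntegral.integral_const_mul,
      intervalIntegral.integral_of_le (by linarith [Real.pi_pos]), integral_Ioc_eq_integral_Ioo] at h1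
    have hr' : (r : ℂ) ≠ 0 := by exact_mod_cast hr.ne'
    simpa [hr'] using h1
  rw [cauchyTransform, ← Complex.integral_comp_polarCoord_symm]
  have : ∫ p in polarCoord.target, p.1 • (cauchyKernel (Complex.polarCoord.symm p) *
        dbar (fderiv ℝ ψ (u - Complex.polarCoord.symm p))) =
      ∫ p in Ioi (0 : ℝ) ×ˢ Ioo (-π) π, ((2 * π : ℂ)⁻¹ * P p + (2 * π : ℂ)⁻¹ * I * Q p) := by
    refine setIntegral_congr_fun (measurableSet_Ioi.prod measurableSet_Ioo) fun p hp => ?_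
    have hp1 : (p.1 : ℂ) ≠ 0 := by exact_mod_cast (ne_of_gt hp.1)
    simp only [Complex.polarCoord_symm_apply, P, Q, cauchyKernel, mul_inv, real_smul, ofReal_cos, ofReal_sin]
    have := dbar_eq_polar (fderiv ℝ ψ (u - p.1 * (Complex.cos p.2 + Complex.sin p.2 * I))) p.2
    calc _ = (p.1 * (p.1 : ℂ)⁻¹) * (π : ℂ)⁻¹ * ((Complex.cos p.2 + Complex.sin p.2 * I)⁻¹ *
          dbar (fderiv ℝ ψ (u - p.1 * (Complex.cos p.2 + Complex.sin p.2 * I)))) := by ring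
      _ = _ := by rw [this, mul_inv_cancel₀ hp1]; ring
  rw [this, integral_add (hPi.const_mul _) (hQi.const_mul _), integral_const_mul,
    integral_const_mul, hI1, hI2]
  have : (π : ℂ) ≠ 0 := by exact_mod_cast Real.pi_ne_zero
  field_simp
  simp

end CauchyTransform

section CauchyTransform

open MeasureTheory Metric Set Filter Topology Complex

lemma integrableOn_norm_cauchyKernel (ε : ℝ) :
    IntegrableOn (fun z => ‖cauchyKernel z‖) (ball 0 ε) :=
  ((locallyIntegrable_cauchyKernel.integrableOn_isCompact
    (isCompact_closedBall 0 ε)).mono_set ball_subset_closedBall).norm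

lemma norm_cauchyKernel_mul_le {g : ℂ → ℂ} {C : ℝ} (hC : ∀ z, ‖g z‖ ≤ C) {ε : ℝ} (hε : 0 < ε)
    (u z : ℂ) : ‖cauchyKernel z * g (u - z)‖ ≤
      C * (ball (0 : ℂ) ε).indicator (fun z => ‖cauchyKernel z‖) z + (π * ε)⁻¹ * ‖g (u - z)‖ := by
  have hC0 : 0 ≤ C := (norm_nonneg _).trans (hC 0)
  rw [norm_mul]
  by_cases h : z ∈ ball (0 : ℂ) ε
  · rw [indicator_of_mem h]
    have h1 := mul_le_mul_of_nonneg_left (hC (u - z)) (norm_nonneg (cauchyKernel z))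
    have : 0 ≤ (π * ε)⁻¹ * ‖g (u - z)‖ := by positivity
    linarith
  · rw [indicator_of_notMem h, norm_cauchyKernel, mul_zero, zero_add, mul_inv]
    have : ε ≤ ‖z‖ := by simpa using h
    gcongr

lemma integrable_cauchyKernel_mul {g : ℂ → ℂ} {C : ℝ} (hC : ∀ z, ‖g z‖ ≤ C) (hg : Integrable g)
    (u : ℂ) : Integrable fun z => cauchyKernel z * g (u - z) := by
  have h1 : Integrable (fun z => C * (ball (0 : ℂ) 1).indicator (fun z => ‖cauchyKernel z‖) z +
      (π * 1)⁻¹ * ‖g (u - z)‖) :=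
    (((integrable_indicator_iff measurableSet_ball).2
      (integrableOn_norm_cauchyKernel 1)).const_mul C).add
      (((hg.comp_sub_left u)).norm.const_mul _)
  exact h1.mono' (measurable_cauchyKernel.aestronglyMeasurable.mul
    (hg.comp_sub_left u).aestronglyMeasurable)
    (Eventually.of_forall fun z => norm_cauchyKernel_mul_le hC one_pos u z)

lemma norm_cauchyTransform_le {g : ℂ → ℂ} {C : ℝ} (hC : ∀ z, ‖g z‖ ≤ C) (hg : Integrable g)
    {ε : ℝ} (hε : 0 < ε) (u : ℂ) :
    ‖cauchyTransform g u‖ ≤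
      C * (∫ z in ball (0 : ℂ) ε, ‖cauchyKernel z‖) + (π * ε)⁻¹ * ∫ z, ‖g z‖ := by
  have h1 := (((integrable_indicator_iff measurableSet_ball).2
      (integrableOn_norm_cauchyKernel ε)).const_mul C)
  have h2 := (((hg.comp_sub_left u)).norm.const_mul (π * ε)⁻¹)
  refine (norm_integral_le_of_norm_le (h1.add h2)
    (Eventually.of_forall fun z => norm_cauchyKernel_mul_le hC hε u z)).trans ?_
  simp only [Pi.add_apply]
  rw [integral_add h1 h2, integral_const_mul, integral_const_mul, integral_indicator measurableSet_ball,
    integral_sub_left_eq_self (fun z => ‖g z‖)]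

lemma tendsto_integral_norm_cauchyKernel :
    Tendsto (fun ε : ℝ => ∫ z in ball (0 : ℂ) ε, ‖cauchyKernel z‖) (𝓝[>] 0) (𝓝 0) := by
  have h0 : Integrable (fun z => (ball (0 : ℂ) 1).indicator (fun z => ‖cauchyKernel z‖) z) :=
    (integrable_indicator_iff measurableSet_ball).2 (integrableOn_norm_cauchyKernel 1)
  have h1 : Tendsto (fun ε : ℝ => volume (ball (0 : ℂ) ε)) (𝓝[>] 0) (𝓝 0) := by
    have h2 : Tendsto (fun ε : ℝ => ENNReal.ofReal ε ^ 2 * NNReal.pi) (𝓝[>] 0)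
        (𝓝 (ENNReal.ofReal 0 ^ 2 * NNReal.pi)) := by
      refine ENNReal.Tendsto.mul_const ?_ (Or.inr ENNReal.coe_ne_top)
      exact ((ENNReal.continuous_pow 2).comp ENNReal.continuous_ofReal).continuousAt.tendsto.mono_left
        nhdsWithin_le_nhds
    simpa [Complex.volume_ball] using h2
  have := h0.tendsto_setIntegral_nhds_zero h1
  refine this.congr' ?_
  filter_upwards [Ioo_mem_nhdsGT (zero_lt_one' ℝ)] with ε hε
  exact setIntegral_congr_fun measurableSet_ball fun z hz =>
    indicator_of_mem (ball_subset_ball hε.2.le hz) _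

lemma cauchyTransform_sub {g h : ℂ → ℂ} {C D : ℝ} (hgC : ∀ z, ‖g z‖ ≤ C) (hg : Integrable g)
    (hhC : ∀ z, ‖h z‖ ≤ D) (hh : Integrable h) (u : ℂ) :
    cauchyTransform (fun z => g z - h z) u = cauchyTransform g u - cauchyTransform h u := by
  simp only [cauchyTransform, mul_sub]
  exact integral_sub (integrable_cauchyKernel_mul hgC hg u) (integrable_cauchyKernel_mul hhC hh u)

/-- Uniformly bounded `L¹`-convergence implies uniform convergence of Cauchy transforms. -/
lemma tendstoUniformly_cauchyTransform {g : ℂ → ℂ} {G : ℕ → ℂ → ℂ} {C : ℝ}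
    (hgC : ∀ z, ‖g z‖ ≤ C) (hg : Integrable g) (hGC : ∀ n z, ‖G n z‖ ≤ C)
    (hG : ∀ n, Integrable (G n))
    (hlim : Tendsto (fun n => ∫ z, ‖G n z - g z‖) atTop (𝓝 0)) :
    TendstoUniformly (fun n => cauchyTransform (G n)) (cauchyTransform g) atTop := by
  rw [Metric.tendstoUniformly_iff]
  intro e he
  have hK : ∀ᶠ ε : ℝ in 𝓝[>] 0, (C + C) * (∫ z in ball (0 : ℂ) ε, ‖cauchyKernel z‖) < e / 2 := by
    have := tendsto_integral_norm_cauchyKernel.const_mul (C + C)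
    rw [mul_zero] at this
    exact this.eventually_lt_const (by positivity)
  obtain ⟨ε, hε1, hε⟩ := (hK.and self_mem_nhdsWithin).exists
  have hε : 0 < ε := hε
  have h2 : ∀ᶠ n in atTop, (π * ε)⁻¹ * ∫ z, ‖G n z - g z‖ < e / 2 := by
    have := hlim.const_mul (π * ε)⁻¹
    rw [mul_zero] at this
    exact this.eventually_lt_const (by positivity)
  filter_upwards [h2] with n hn u
  rw [dist_comm, dist_eq_norm, ← cauchyTransform_sub (hGC n) (hG n) hgC hg]
  have := norm_cauchyTransform_le (g := fun z => G n z - g z) (C := C + C)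
    (fun z => (norm_sub_le _ _).trans (add_le_add (hGC n z) (hgC z))) ((hG n).sub hg) hε u
  linarith

lemma integrable_of_bounded_support {g : ℂ → ℂ} {C R : ℝ} (hm : Measurable g)
    (hC : ∀ z, ‖g z‖ ≤ C) (hR : ∀ z, R < ‖z‖ → g z = 0) : Integrable g := by
  have h1 : IntegrableOn g (closedBall 0 R) :=
    IntegrableOn.of_bound measure_closedBall_lt_top hm.aestronglyMeasurable C
      (Eventually.of_forall hC)
  rwa [integrableOn_iff_integrable_of_support_subset] at h1
  intro z hz
  by_contra h
  exact hz (hR z (by simpa using h))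

/-- Mollification of a bounded compactly supported measurable function. -/
lemma exists_smooth_approx {g : ℂ → ℂ} {C R : ℝ} (hm : Measurable g)
    (hC : ∀ z, ‖g z‖ ≤ C) (hR : ∀ z, R < ‖z‖ → g z = 0) :
    ∃ G : ℕ → ℂ → ℂ, (∀ n, ContDiff ℝ 1 (G n)) ∧ (∀ n, HasCompactSupport (G n)) ∧
      (∀ n z, ‖G n z‖ ≤ C) ∧ (∀ n, Integrable (G n)) ∧
      Tendsto (fun n => ∫ z, ‖G n z - g z‖) atTop (𝓝 0) := by
  have hgi := integrable_of_bounded_support hm hC hR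
  have hC0 : 0 ≤ C := (norm_nonneg _).trans (hC 0)
  let φ : ℕ → ContDiffBump (0 : ℂ) := fun n =>
    ⟨1 / (2 * (n + 1)), 1 / (n + 1), by positivity, by
      apply one_div_lt_one_div_of_lt <;> [positivity; (have : (0 : ℝ) ≤ n := n.cast_nonneg; linarith)]⟩
  have hrout : ∀ n, (φ n).rOut = 1 / ((n : ℝ) + 1) := fun n => rfl
  have hrin : ∀ n, (φ n).rIn = 1 / (2 * ((n : ℝ) + 1)) := fun n => rfl
  have hrout1 : ∀ n, (φ n).rOut ≤ 1 := fun n => by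
    rw [hrout, div_le_one (by positivity)]; have : (0 : ℝ) ≤ n := n.cast_nonneg; linarith
  let G : ℕ → ℂ → ℂ := fun n =>
    MeasureTheory.convolution ((φ n).normed volume) g (ContinuousLinearMap.lsmul ℝ ℝ) volume
  have hGz : ∀ n z, R + 1 < ‖z‖ → G n z = 0 := by
    intro n z hz
    simp only [G, MeasureTheory.convolution]
    refine integral_eq_zero_of_ae (Eventually.of_forall fun w => ?_)
    simp only [Pi.zero_apply]
    by_cases hw : ‖w‖ < 1
    · rw [hR (z - w) (by have := norm_sub_norm_le z w; linarith)]; simp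
    · have : (φ n).normed volume w = 0 := by
        have h3 : w ∉ Function.support ((φ n).normed volume) := by
          rw [(φ n).support_normed_eq]
          simp only [mem_ball_zero_iff, not_lt] at hw ⊢
          exact (hrout1 n).trans hw
        simpa using h3
      simp [this]
  have hGC : ∀ n z, ‖G n z‖ ≤ C := by
    intro n z
    simp only [G, MeasureTheory.convolution]
    refine (norm_integral_le_of_norm_le (g := fun w => (φ n).normed volume w * C)
      ((φ n).integrable_normed.mul_const C) (Eventually.of_forall fun w => ?_)).trans ?_
    · simp only [ContinuousLinearMap.lsmul_apply, norm_smul, Real.norm_eq_abs,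
        abs_of_nonneg ((φ n).nonneg_normed w)]
      exact mul_le_mul_of_nonneg_left (hC _) ((φ n).nonneg_normed w)
    · rw [integral_mul_const, (φ n).integral_normed, one_mul]
  have hGcont : ∀ n, ContDiff ℝ 1 (G n) := fun n =>
    (φ n).hasCompactSupport_normed.contDiff_convolution_left _ (φ n).contDiff_normed
      hgi.locallyIntegrable
  have hGcs : ∀ n, HasCompactSupport (G n) := fun n =>
    HasCompactSupport.intro (isCompact_closedBall (0 : ℂ) (R + 1)) fun z hz =>
      hGz n z (by simpa using hz)
  have hGi : ∀ n, Integrable (G n) := fun n =>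
    (hGcont n).continuous.integrable_of_hasCompactSupport (hGcs n)
  refine ⟨G, hGcont, hGcs, hGC, hGi, ?_⟩
  have hae : ∀ᵐ z, Tendsto (fun n => G n z) atTop (𝓝 (g z)) := by
    refine ContDiffBump.ae_convolution_tendsto_right_of_locallyIntegrable (K := 2) ?_ ?_
      hgi.locallyIntegrable
    · simp_rw [hrout]; exact tendsto_one_div_add_atTop_nhds_zero_nat
    · refine Eventually.of_forall fun n => le_of_eq ?_
      rw [hrout, hrin]; field_simp
  have := tendsto_integral_of_dominated_convergence (F := fun n z => ‖G n z - g z‖)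
    (f := fun _ => (0 : ℝ)) (μ := (volume : Measure ℂ))
    ((closedBall (0 : ℂ) (R + 1)).indicator fun _ => C + C) ?_ ?_ ?_ ?_
  · simpa using this
  · exact fun n => ((hGi n).sub hgi).aestronglyMeasurable.norm
  · rw [integrable_indicator_iff measurableSet_closedBall]
    exact integrableOn_const measure_closedBall_lt_top.ne
  · refine fun n => Eventually.of_forall fun z => ?_
    by_cases hz : z ∈ closedBall (0 : ℂ) (R + 1)
    · rw [indicator_of_mem hz, norm_norm]
      exact (norm_sub_le _ _).trans (add_le_add (hGC n z) (hC z))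
    · have : R + 1 < ‖z‖ := by simpa using hz
      rw [indicator_of_notMem hz, hGz n z this, hR z (by linarith)]; simp
  · filter_upwards [hae] with z hz
    have := (hz.sub_const (g z)).norm
    simpa using this

end CauchyTransform

section CauchyTransform

open MeasureTheory Metric Set Filter Topology Complex
open scoped Interval

lemma dbar_sub (L L' : ℂ →L[ℝ] ℂ) : dbar (L - L') = dbar L - dbar L' := by
  simp [dbar]; ring

lemma dbar_smul (c : ℂ) (L : ℂ →L[ℝ] ℂ) : dbar (c • L) = c * dbar L := by
  simp [dbar]; ring

lemma hasFDerivAt_cauchyTransform {g : ℂ → ℂ} (hg : ContDiff ℝ 1 g) (hc : HasCompactSupport g)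
    (u : ℂ) : ∃ L : ℂ →L[ℝ] ℂ, HasFDerivAt (cauchyTransform g) L u ∧ dbar L = g u := by
  have h := hc.hasFDerivAt_convolution_right (ContinuousLinearMap.mul ℝ ℂ)
    locallyIntegrable_cauchyKernel hg u
  refine ⟨_, h, ?_⟩
  rw [← cauchyTransform_dbar hg hc u]
  have hi : ConvolutionExistsAt cauchyKernel (fderiv ℝ g) u
      ((ContinuousLinearMap.mul ℝ ℂ).precompR ℂ) volume :=
    (hc.fderiv ℝ).convolutionExists_right _ locallyIntegrable_cauchyKernel
      (hg.continuous_fderiv one_ne_zero) u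
  have e : ∀ v : ℂ, (MeasureTheory.convolution cauchyKernel (fderiv ℝ g)
      ((ContinuousLinearMap.mul ℝ ℂ).precompR ℂ) volume u) v =
      ∫ z, cauchyKernel z * fderiv ℝ g (u - z) v := by
    intro v
    rw [MeasureTheory.convolution, ContinuousLinearMap.integral_apply hi]
    rfl
  have hv : ∀ v : ℂ, Integrable fun z => cauchyKernel z * fderiv ℝ g (u - z) v := fun v =>
    (ContinuousLinearMap.apply ℝ ℂ v).integrable_comp hi
  rw [dbar, e, e, cauchyTransform]
  simp only [dbar]
  rw [← integral_const_mul, ← integral_add (hv 1) ((hv I).const_mul I), ← integral_div]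
  congr 1; ext z; ring

lemma norm_integral_rectangle_le {H : ℂ → ℂ} {N : ℂ → ℝ} (hN : Integrable N) (hN0 : ∀ u, 0 ≤ N u)
    (z w : ℂ) (h : ∀ u ∈ [[z.re, w.re]] ×ℂ [[z.im, w.im]], ‖H u‖ ≤ N u) :
    ‖∫ x in z.re..w.re, ∫ y in z.im..w.im, H (x + y * I)‖ ≤ ∫ u, N u := by
  have hN' : Integrable (fun p : ℝ × ℝ => N (p.1 + p.2 * I)) := by
    have := (Complex.volume_preserving_equiv_real_prod.symm).integrable_comp_of_integrable hN
    refine this.congr (Eventually.of_forall fun p => ?_)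
    simp [Complex.measurableEquivRealProd_symm_apply, Complex.mk_eq_add_mul_I]
  have hNe : ∫ u, N u = ∫ x : ℝ, ∫ y : ℝ, N (x + y * I) := by
    rw [← (Complex.volume_preserving_equiv_real_prod.symm).integral_comp
      measurableEquivRealProd.symm.measurableEmbedding]
    have hvol : (volume : Measure (ℝ × ℝ)) = (volume : Measure ℝ).prod volume := rfl
    rw [hvol] at hN' ⊢
    rw [← integral_prod _ hN']
    congr 1; ext p
    simp [Complex.measurableEquivRealProd_symm_apply, Complex.mk_eq_add_mul_I]
  have hvol : (volume : Measure (ℝ × ℝ)) = (volume : Measure ℝ).prod volume := rfl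
  rw [hvol] at hN'
  have hout := hN'.integral_prod_left
  refine intervalIntegral.norm_integral_le_integral_norm_uIoc.trans ?_
  rw [hNe]
  refine (integral_mono_of_nonneg (Eventually.of_forall fun _ => norm_nonneg _)
    hout.integrableOn (g := fun x : ℝ => ∫ y : ℝ, N (x + y * I)) ?_).trans
    (setIntegral_le_integral hout (Eventually.of_forall fun x => integral_nonneg fun y => hN0 _))
  filter_upwards [ae_restrict_of_ae hN'.prod_right_ae, ae_restrict_mem measurableSet_uIoc]
    with x hx hxm
  refine intervalIntegral.norm_integral_le_integral_norm_uIoc.trans ?_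
  refine (integral_mono_of_nonneg (Eventually.of_forall fun _ => norm_nonneg _)
    hx.integrableOn (g := fun y : ℝ => N (x + y * I)) ?_).trans
    (setIntegral_le_integral hx (Eventually.of_forall fun y => hN0 _))
  filter_upwards [ae_restrict_mem measurableSet_uIoc] with y hym
  apply h
  rw [mem_reProdIm]
  simpa using ⟨uIoc_subset_uIcc hxm, uIoc_subset_uIcc hym⟩

/-- The similarity principle: solutions of `∂δ/∂z̄ = β δ` are holomorphic up to a bounded
continuous exponential factor, which depends only on `β`. -/
theorem exists_similarity (C R : ℝ) : ∃ M : ℝ, ∀ β : ℂ → ℂ, Measurable β → (∀ z, ‖β z‖ ≤ C) →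
    (∀ z, R < ‖z‖ → β z = 0) → ∃ s : ℂ → ℂ, Continuous s ∧ (∀ z, ‖s z‖ ≤ M) ∧
    ∀ (c : ℂ) (r : ℝ) (δ : ℂ → ℂ) (δ' : ℂ → ℂ →L[ℝ] ℂ),
      (∀ u ∈ ball c r, HasFDerivAt δ (δ' u) u) → (∀ u ∈ ball c r, dbar (δ' u) = β u * δ u) →
      DifferentiableOn ℂ (fun u => Complex.exp (-s u) * δ u) (ball c r) := by
  refine ⟨C * (∫ z in ball (0 : ℂ) 1, ‖cauchyKernel z‖) +
    (π * 1)⁻¹ * (∫ z : ℂ, (closedBall (0 : ℂ) R).indicator (fun _ => C) z), ?_⟩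
  set M := C * (∫ z in ball (0 : ℂ) 1, ‖cauchyKernel z‖) +
    (π * 1)⁻¹ * (∫ z : ℂ, (closedBall (0 : ℂ) R).indicator (fun _ => C) z) with hM
  intro β hm hC hR
  have hβi := integrable_of_bounded_support hm hC hR
  have hC0 : 0 ≤ C := (norm_nonneg _).trans (hC 0)
  obtain ⟨G, hG1, hGs, hGC, hGi, hGlim⟩ := exists_smooth_approx hm hC hR
  have hunif := tendstoUniformly_cauchyTransform hC hβi hGC hGi hGlim
  have hsn : ∀ n, Differentiable ℝ (cauchyTransform (G n)) := fun n u =>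
    (hasFDerivAt_cauchyTransform (hG1 n) (hGs n) u).choose_spec.1.differentiableAt
  have hs : Continuous (cauchyTransform β) :=
    hunif.continuous (Frequently.of_forall fun n => (hsn n).continuous)
  have hsM : ∀ u, ‖cauchyTransform β u‖ ≤ M := by
    intro u
    refine (norm_cauchyTransform_le hC hβi one_pos u).trans ?_
    rw [hM]
    gcongr
    · exact hβi.norm
    · rw [integrable_indicator_iff measurableSet_closedBall]
      exact integrableOn_const measure_closedBall_lt_top.ne
    · intro z
      beta_reduce
      by_cases hz : z ∈ closedBall (0 : ℂ) R
      · rw [indicator_of_mem hz]; exact hC z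
      · rw [indicator_of_notMem hz, hR z (by simpa using hz)]; simp
  refine ⟨cauchyTransform β, hs, hsM, ?_⟩
  intro c r δ δ' hδ hdb
  have hδc : ContinuousOn δ (ball c r) := fun u hu => (hδ u hu).continuousAt.continuousWithinAt
  rw [← Complex.isConservativeOn_and_continuousOn_iff_isDifferentiableOn]
  swap; · exact isOpen_ball
  refine ⟨?_, (hs.neg.cexp).continuousOn.mul hδc⟩
  intro z w hzw
  rw [← add_eq_zero_iff_eq_neg, wedgeIntegral_add_wedgeIntegral_eq]
  have hbd : ∀ᶠ n in atTop, ∀ u, ‖cauchyTransform (G n) u‖ ≤ M + 1 := by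
    filter_upwards [Metric.tendstoUniformly_iff.1 hunif 1 one_pos] with n hn u
    have h1 := hn u
    rw [dist_comm, dist_eq_norm] at h1
    have := norm_le_norm_add_norm_sub' (cauchyTransform (G n) u) (cauchyTransform β u)
    linarith [hsM u]
  have hexp : ∀ {x : ℂ}, ‖x‖ ≤ M + 1 → ‖Complex.exp (-x)‖ ≤ rexp (M + 1) := fun {x} hx =>
    (Complex.norm_exp_le_exp_norm _).trans (Real.exp_le_exp.2 (by rwa [norm_neg]))
  have hline : ∀ (γ : ℝ → ℂ) (a b : ℝ), Continuous γ → (∀ x ∈ [[a, b]], γ x ∈ ball c r) →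
      Tendsto (fun n => ∫ x in a..b, Complex.exp (-cauchyTransform (G n) (γ x)) * δ (γ x)) atTop
        (𝓝 (∫ x in a..b, Complex.exp (-cauchyTransform β (γ x)) * δ (γ x))) := by
    intro γ a b hγ hmem
    have hc1 : ContinuousOn (fun x => δ (γ x)) [[a, b]] := hδc.comp hγ.continuousOn hmem
    refine intervalIntegral.tendsto_integral_filter_of_dominated_convergence
      (fun x => rexp (M + 1) * ‖δ (γ x)‖) ?_ ?_ ?_ ?_
    · refine Eventually.of_forall fun n => ?_
      refine ContinuousOn.aestronglyMeasurable ?_ measurableSet_uIoc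
      exact ((((hsn n).continuous.comp hγ).neg.cexp).continuousOn.mul hc1).mono uIoc_subset_uIcc
    · filter_upwards [hbd] with n hn
      refine Eventually.of_forall fun x _ => ?_
      rw [norm_mul]
      gcongr
      exact hexp (hn _)
    · exact (continuousOn_const.mul hc1.norm).intervalIntegrable
    · refine Eventually.of_forall fun x _ => ?_
      exact ((hunif.tendsto_at (γ x)).neg.cexp).mul_const _
  have hzw' : ∀ x ∈ [[z.re, w.re]], ∀ y ∈ [[z.im, w.im]], (x + y * I : ℂ) ∈ ball c r :=
    fun x hx y hy => hzw (by rw [Rectangle, mem_reProdIm]; simpa using ⟨hx, hy⟩)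
  have hbdry := (((hline (fun x => x + z.im * I) z.re w.re (by fun_prop)
      fun x hx => hzw' x hx _ left_mem_uIcc).sub
    (hline (fun x => x + w.im * I) z.re w.re (by fun_prop)
      fun x hx => hzw' x hx _ right_mem_uIcc)).add
    ((hline (fun y => w.re + y * I) z.im w.im (by fun_prop)
      fun y hy => hzw' _ right_mem_uIcc y hy).const_smul I)).sub
    ((hline (fun y => z.re + y * I) z.im w.im (by fun_prop)
      fun y hy => hzw' _ left_mem_uIcc y hy).const_smul I)
  refine tendsto_nhds_unique hbdry ?_
  have hcomp : IsCompact (Rectangle z w) := isCompact_uIcc.reProdIm isCompact_uIcc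
  obtain ⟨K, hK⟩ := hcomp.exists_bound_of_continuousOn (hδc.mono hzw)
  have hK0 : 0 ≤ K := (norm_nonneg _).trans (hK z (by simp [Rectangle, mem_reProdIm]))
  have hb := hGlim.const_mul (2 * rexp (M + 1) * K)
  rw [mul_zero] at hb
  refine squeeze_zero_norm' ?_ hb
  filter_upwards [hbd] with n hn
  choose L hL hLd using hasFDerivAt_cauchyTransform (hG1 n) (hGs n)
  have hφ : ∀ u ∈ ball c r, HasFDerivAt (fun u => Complex.exp (-cauchyTransform (G n) u) * δ u)
      (Complex.exp (-cauchyTransform (G n) u) • (δ' u - δ u • L u)) u := by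
    intro u hu
    have h1 := ((hL u).neg.cexp).mul (hδ u hu)
    refine h1.congr_fderiv ?_
    ext v
    simp
    ring
  set f' : ℂ → ℂ →L[ℝ] ℂ := fun u => Complex.exp (-cauchyTransform (G n) u) • (δ' u - δ u • L u)
  have hf' : ∀ u ∈ ball c r, I • f' u 1 - f' u I =
      2 * I * (Complex.exp (-cauchyTransform (G n) u) * δ u * (β u - G n u)) := by
    intro u hu
    have h1 : dbar (f' u) = Complex.exp (-cauchyTransform (G n) u) * δ u * (β u - G n u) := by
      simp only [f']
      rw [dbar_smul, dbar_sub, dbar_smul, hdb u hu, hLd]; ring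
    rw [← h1, dbar, smul_eq_mul]
    linear_combination - f' u I * I_sq
  have hle : ∀ u ∈ Rectangle z w, ‖I • f' u 1 - f' u I‖ ≤
      2 * rexp (M + 1) * K * ‖G n u - β u‖ := by
    intro u hu
    rw [hf' u (hzw hu), norm_mul, norm_mul, norm_mul, norm_mul, norm_I, Complex.norm_ofNat, mul_one,
      norm_sub_rev (β u)]
    have h1 := hexp (hn u)
    have h2 := hK u hu
    calc _ ≤ 2 * (rexp (M + 1) * K * ‖G n u - β u‖) := by gcongr
      _ = _ := by ring
  rw [integral_boundary_rect_of_continuousOn_of_hasFDerivAt_real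
    (fun u => Complex.exp (-cauchyTransform (G n) u) * δ u) f' z w]
  · refine (norm_integral_rectangle_le (H := fun u => I • f' u 1 - f' u I)
      (((hGi n).sub hβi).norm.const_mul (2 * rexp (M + 1) * K))
      (fun u => by positivity) z w hle).trans_eq ?_
    rw [integral_const_mul]; rfl
  · exact (((hsn n).continuous.neg.cexp).continuousOn.mul hδc).mono hzw
  · intro u hu
    apply hφ
    apply hzw
    simp only [Rectangle, mem_reProdIm] at hu ⊢
    exact ⟨Ioo_subset_Icc_self hu.1, Ioo_subset_Icc_self hu.2⟩
  · refine IntegrableOn.congr_fun (f := fun u =>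
      2 * I * (Complex.exp (-cauchyTransform (G n) u) * δ u * (β u - G n u))) ?_
      (fun u hu => (hf' u (hzw hu)).symm) hcomp.measurableSet
    refine Integrable.const_mul (μ := volume.restrict _) ?_ _
    refine IntegrableOn.continuousOn_mul ?_ (hβi.sub (hGi n)).integrableOn hcomp
    exact (((hsn n).continuous.neg.cexp).continuousOn.mul hδc).mono hzw

end CauchyTransform

section FixedPoint

open MeasureTheory Metric Set Filter Topology Complex
open scoped ComplexConjugate

/-- The real-linear map `w ↦ a w + b w̄`. -/
noncomputable def wirtinger (a b : ℂ) : ℂ →L[ℝ] ℂ :=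
  a • ContinuousLinearMap.id ℝ ℂ + b • (Complex.conjCLE : ℂ →L[ℝ] ℂ)

@[simp] lemma wirtinger_apply (a b w : ℂ) : wirtinger a b w = a * w + b * conj w := by
  simp [wirtinger]

@[simp] lemma dbar_wirtinger (a b : ℂ) : dbar (wirtinger a b) = b := by
  simp only [dbar, wirtinger_apply, map_one, conj_I]
  linear_combination (a / 2 - b / 2) * I_sq

lemma continuous_dbar : Continuous dbar := by
  unfold dbar; fun_prop

lemma hasDerivAt_of_wirtinger_zero {f : ℂ → ℂ} {a u : ℂ} (h : HasFDerivAt f (wirtinger a 0) u) :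
    HasDerivAt f a u := by
  rw [hasDerivAt_iff_hasFDerivAt]
  refine hasFDerivAt_of_restrictScalars ℝ h ?_
  ext w; simp [mul_comm]

/-- An almost holomorphic self-map of the disk with relatively compact image has at most one
fixed point. -/
theorem fixedPoint_unique {N : ℂ → ℂ} {N' : ℂ → ℂ →L[ℝ] ℂ} {c : ℂ → ℂ} {ρ : ℝ} (hρ : ρ < 1)
    (hN : ∀ u ∈ ball (0 : ℂ) 1, HasFDerivAt N (N' u) u) (hN' : ContinuousOn N' (ball 0 1))
    (hNρ : ∀ u ∈ ball (0 : ℂ) 1, ‖N u‖ ≤ ρ) (hc : ContinuousOn c (ball 0 1))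
    (hdb : ∀ u ∈ ball (0 : ℂ) 1, dbar (N' u) = c u * conj (N u - u))
    {t t' : ℂ} (ht : t ∈ ball (0 : ℂ) 1) (ht' : t' ∈ ball (0 : ℂ) 1) (hNt : N t = t)
    (hNt' : N t' = t') : t' = t := by
  by_contra hne
  have hρ0 : 0 ≤ ρ := (norm_nonneg _).trans (hNρ t ht)
  obtain ⟨r0, hr0, hr01⟩ : ∃ r0, max ρ (max ‖t‖ ‖t'‖) < r0 ∧ r0 < 1 :=
    exists_between (max_lt hρ (max_lt (by simpa using ht) (by simpa using ht')))
  obtain ⟨r1, hr1, hr11⟩ := exists_between hr01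
  simp only [max_lt_iff] at hr0
  obtain ⟨hρr, htr, htr'⟩ := hr0
  have hr0p : 0 < r0 := hρ0.trans_lt hρr
  let χ : ContDiffBump (0 : ℂ) := ⟨r0, r1, hr0p, hr1⟩
  have hχ1 : ∀ u, ‖u‖ ≤ r0 → χ u = 1 := fun u hu =>
    χ.one_of_mem_closedBall (by simpa [χ] using hu)
  have hχ0 : ∀ u, r1 ≤ ‖u‖ → χ u = 0 := fun u hu => χ.zero_of_le_dist (by simpa [χ] using hu)
  have hχd : ContDiff ℝ 1 χ := χ.contDiff
  let δ : ℂ → ℂ := fun u => χ u • N u - u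
  let δ' : ℂ → ℂ →L[ℝ] ℂ := fun u =>
    χ u • N' u + (fderiv ℝ χ u).smulRight (N u) - ContinuousLinearMap.id ℝ ℂ
  have hδin : ∀ u ∈ ball (0 : ℂ) 1, HasFDerivAt δ (δ' u) u := fun u hu =>
    ((hχd.differentiable one_ne_zero u).hasFDerivAt.smul (hN u hu)).sub (hasFDerivAt_id u)
  have hδout : ∀ u, r1 < ‖u‖ → HasFDerivAt δ (wirtinger (-1) 0) u := by
    intro u hu
    have h1 : δ =ᶠ[𝓝 u] fun u => -u := by
      filter_upwards [(isOpen_lt continuous_const continuous_norm).mem_nhds hu] with v hv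
      simp only [δ]; rw [hχ0 v (le_of_lt hv)]; simp
    refine (HasFDerivAt.congr_of_eventuallyEq ?_ h1)
    refine (hasFDerivAt_id (𝕜 := ℝ) u).neg.congr_fderiv ?_
    ext w; simp
  have hδd : Differentiable ℝ δ := by
    intro u
    by_cases hu : ‖u‖ < 1
    · exact (hδin u (by simpa using hu)).differentiableAt
    · exact (hδout u (by linarith)).differentiableAt
  have hδnear : ∀ u, ‖u‖ < r0 → HasFDerivAt δ (N' u - ContinuousLinearMap.id ℝ ℂ) u := by
    intro u hu
    have h1 : δ =ᶠ[𝓝 u] fun u => N u - u := by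
      filter_upwards [(isOpen_lt continuous_norm continuous_const).mem_nhds hu] with v hv
      simp only [δ]; rw [hχ1 v (le_of_lt hv)]; simp
    exact ((hN u (by simpa using hu.trans hr01)).sub (hasFDerivAt_id u)).congr_of_eventuallyEq h1
  have hδfd : ∀ u, ‖u‖ < r0 → dbar (fderiv ℝ δ u) = c u * conj (δ u) := by
    intro u hu
    have h2 : dbar (ContinuousLinearMap.id ℝ ℂ) = 0 := by simp [dbar]
    rw [(hδnear u hu).fderiv, dbar_sub, h2, sub_zero, hdb u (by simpa using hu.trans hr01)]
    simp only [δ]; rw [hχ1 u hu.le]; simp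
  have hNc : ContinuousOn N (ball 0 1) := fun u hu => (hN u hu).continuousAt.continuousWithinAt
  have hδ'c : ContinuousOn δ' (ball 0 1) := by
    refine ((hχd.continuous.continuousOn.smul hN').add ?_).sub continuousOn_const
    have h3 : Continuous (fderiv ℝ χ) := hχd.continuous_fderiv one_ne_zero
    exact ((ContinuousLinearMap.smulRightL ℝ ℂ ℂ).continuous.comp_continuousOn
      h3.continuousOn).clm_apply hNc
  have hsub0 : closedBall (0 : ℂ) r0 ⊆ ball 0 1 := closedBall_subset_ball hr01
  have hsub1 : closedBall (0 : ℂ) r1 ⊆ ball 0 1 := closedBall_subset_ball hr11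
  obtain ⟨C, hC⟩ := (isCompact_closedBall (0 : ℂ) r0).exists_bound_of_continuousOn (hc.mono hsub0)
  obtain ⟨D, hD⟩ := (isCompact_closedBall (0 : ℂ) r1).exists_bound_of_continuousOn
    (continuous_dbar.comp_continuousOn (hδ'c.mono hsub1))
  have hC0 : 0 ≤ C := (norm_nonneg _).trans (hC 0 (by simp [hr0p.le]))
  have hD0 : 0 ≤ D := (norm_nonneg _).trans (hD 0 (by simp [(hr0p.trans hr1).le]))
  let β : ℂ → ℂ := fun u => dbar (fderiv ℝ δ u) / δ u
  have hβm : Measurable β :=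
    (continuous_dbar.measurable.comp (measurable_fderiv ℝ δ)).div hδd.continuous.measurable
  have hχN : ∀ u, ‖χ u • N u‖ ≤ ρ := by
    intro u
    by_cases hu : ‖u‖ < 1
    · rw [norm_smul, Real.norm_eq_abs, abs_of_nonneg χ.nonneg]
      have h1 := hNρ u (by simpa using hu)
      calc _ ≤ 1 * ρ := mul_le_mul χ.le_one h1 (norm_nonneg _) zero_le_one
        _ = ρ := one_mul _
    · rw [hχ0 u (by linarith)]; simpa using hρ0
  have hδlow : ∀ u, ‖u‖ - ρ ≤ ‖δ u‖ := by
    intro u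
    have := norm_sub_norm_le u (χ u • N u)
    rw [norm_sub_rev] at this
    have h2 : ‖δ u‖ = ‖χ u • N u - u‖ := rfl
    linarith [hχN u]
  have hδup : ∀ u, ‖δ u‖ ≤ ‖u‖ + 1 := by
    intro u
    have h2 : ‖δ u‖ = ‖χ u • N u - u‖ := rfl
    have := norm_sub_le (χ u • N u) u
    linarith [hχN u]
  have hβout : ∀ u, r1 < ‖u‖ → β u = 0 := by
    intro u hu
    simp [β, (hδout u hu).fderiv]
  have hβC : ∀ u, ‖β u‖ ≤ max C (D / (r0 - ρ)) := by
    intro u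
    rcases lt_or_ge ‖u‖ r0 with hu | hu
    · refine le_max_of_le_left ?_
      simp only [β]
      rw [hδfd u hu, mul_div_assoc, norm_mul, norm_div, RCLike.norm_conj]
      calc _ ≤ C * 1 := mul_le_mul (hC u (by simpa using hu.le)) (div_self_le_one _)
            (by positivity) hC0
        _ = C := mul_one C
    · rcases le_or_gt ‖u‖ r1 with hu1 | hu1
      · refine le_max_of_le_right ?_
        have hu2 : u ∈ closedBall (0 : ℂ) r1 := by simpa using hu1
        simp only [β]
        rw [(hδin u (hsub1 hu2)).fderiv, norm_div]
        have h1 := hδlow u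
        have h2 : 0 < r0 - ρ := by linarith
        gcongr
        · exact hD u hu2
        · linarith
      · rw [hβout u hu1, norm_zero]
        exact le_max_of_le_left hC0
  obtain ⟨M, hM⟩ := exists_similarity (max C (D / (r0 - ρ))) r1
  obtain ⟨s, hs, hsM, hhol⟩ := hM β hβm hβC hβout
  have hφ : Differentiable ℂ (fun u => Complex.exp (-s u) * δ u) := by
    intro u
    have := hhol 0 (‖u‖ + 1) δ (fderiv ℝ δ) (fun v _ => (hδd v).hasFDerivAt) (fun v _ => ?_)
    · exact this.differentiableAt (isOpen_ball.mem_nhds (by simp))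
    · by_cases h0 : δ v = 0
      · have hv : ‖v‖ < r0 := by
          have := hδlow v
          rw [h0, norm_zero] at this
          linarith
        rw [hδfd v hv, h0]; simp
      · simp only [β]; rw [div_mul_cancel₀ _ h0]
  set φ : ℂ → ℂ := fun u => Complex.exp (-s u) * δ u with hφdef
  have hφup : ∀ u, ‖φ u‖ ≤ rexp M * (‖u‖ + 1) := by
    intro u
    simp only [φ]
    rw [norm_mul]
    refine mul_le_mul ?_ (hδup u) (norm_nonneg _) (Real.exp_pos _).le
    exact (Complex.norm_exp_le_exp_norm _).trans (Real.exp_le_exp.2 (by rw [norm_neg]; exact hsM u))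
  have hz : ∀ v, ‖v‖ < r0 → N v = v → φ v = 0 := by
    intro v hv hNv
    simp only [φ, δ]; rw [hχ1 v hv.le, hNv]; simp
  have hφt := hz t htr hNt
  have hφt' := hz t' htr' hNt'
  have hψ : Differentiable ℂ (dslope φ t) := by
    rw [← differentiableOn_univ, Complex.differentiableOn_dslope univ_mem]
    exact hφ.differentiableOn
  have hψb : Bornology.IsBounded (range (dslope φ t)) := by
    obtain ⟨K, hK⟩ := (isCompact_closedBall t 1).exists_bound_of_continuousOn
      hψ.continuous.continuousOn
    rw [isBounded_iff_forall_norm_le]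
    refine ⟨max K (rexp M * (‖t‖ + 2)), ?_⟩
    rintro _ ⟨u, rfl⟩
    by_cases hu : u ∈ closedBall t 1
    · exact (hK u hu).trans (le_max_left _ _)
    · refine le_max_of_le_right ?_
      have h1 : 1 < ‖u - t‖ := by simpa [dist_eq_norm] using hu
      have hut : u ≠ t := by rintro rfl; simp at h1; linarith
      rw [dslope_of_ne _ hut, slope_def_field, hφt, sub_zero, norm_div, div_le_iff₀ (by linarith)]
      refine (hφup u).trans ?_
      rw [mul_assoc]
      refine mul_le_mul_of_nonneg_left ?_ (Real.exp_pos _).le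
      have := norm_le_norm_add_norm_sub' u t
      nlinarith [norm_nonneg t]
  have hconst : ∀ u, dslope φ t u = 0 := by
    intro u
    rw [hψ.apply_eq_apply_of_bounded hψb u t', dslope_of_ne _ hne, slope_def_field, hφt, hφt']
    simp
  have h2 : φ 2 = 0 := by
    have h3 := sub_smul_dslope φ t 2
    rw [hconst, smul_zero, hφt, sub_zero] at h3
    exact h3.symm
  have h4 := hδlow 2
  have h5 : δ 2 = 0 := by simpa [φ] using h2
  rw [h5, Complex.norm_ofNat, norm_zero] at h4
  linarith

end FixedPoint

section FixedPoint

open MeasureTheory Metric Set Filter Topology Complex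
open scoped ComplexConjugate

lemma continuous_wirtinger : Continuous fun p : ℂ × ℂ => wirtinger p.1 p.2 := by
  unfold wirtinger; fun_prop

lemma wirtinger_comp (a b h k : ℂ) :
    (wirtinger a b).comp (wirtinger h k) = wirtinger (a * h + b * conj k) (a * k + b * conj h) := by
  ext w; simp; ring

set_option maxHeartbeats 800000 in
/-- If `q` and `F` satisfy Beltrami-type equations matched to each other, and `q ∘ F` is tangent to
the identity at a fixed point, then `q ∘ F` is the identity. -/
theorem comp_eq_self_of_tangent {q a F h : ℂ → ℂ} {t : ℂ}
    (hq : ∀ z ∈ ball (0 : ℂ) 1, HasFDerivAt q (wirtinger (a z) (conj (q z) ^ 2 * a z)) z)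
    (ha : ContinuousOn a (ball 0 1)) (hq1 : ∀ z ∈ ball (0 : ℂ) 1, ‖q z‖ < 1)
    (hF : ∀ u ∈ ball (0 : ℂ) 1, HasFDerivAt F (wirtinger (h u) (-conj (u ^ 2 * h u))) u)
    (hh : ContinuousOn h (ball 0 1)) (hF1 : ∀ u ∈ ball (0 : ℂ) 1, ‖F u‖ < 1)
    (ht : t ∈ ball (0 : ℂ) 1) (hFt : F t = 0) (hqt : q 0 = t)
    (hnorm : a 0 * h t * (1 - conj t ^ 2 * t ^ 2) = 1) :
    ∀ u ∈ ball (0 : ℂ) 1, q (F u) = u := by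
  by_contra! hcon
  obtain ⟨u1, hu1, hne⟩ := hcon
  have hqc : ContinuousOn q (ball 0 1) := fun u hu => (hq u hu).continuousAt.continuousWithinAt
  have hFc : ContinuousOn F (ball 0 1) := fun u hu => (hF u hu).continuousAt.continuousWithinAt
  have hmem : ∀ l : ℝ, 0 ≤ l → l ≤ 1 → ∀ u ∈ ball (0 : ℂ) 1, (l * F u : ℂ) ∈ ball (0 : ℂ) 1 := by
    intro l hl0 hl1 u hu
    have := hF1 u hu
    simp only [mem_ball_zero_iff, norm_mul, norm_real, Real.norm_eq_abs, abs_of_nonneg hl0]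
    nlinarith [norm_nonneg (F u)]
  let N : ℝ → ℂ → ℂ := fun l u => q (l * F u)
  let c : ℝ → ℂ → ℂ := fun l u => l * a (l * F u) * conj (h u) * (conj (N l u) + conj u)
  let A : ℝ → ℂ → ℂ := fun l u => l * a (l * F u) * h u * (1 - conj (N l u) ^ 2 * u ^ 2)
  have hN : ∀ l : ℝ, 0 ≤ l → l ≤ 1 → ∀ u ∈ ball (0 : ℂ) 1,
      HasFDerivAt (N l) (wirtinger (A l u) (c l u * conj (N l u - u))) u := by
    intro l hl0 hl1 u hu
    have h1 : HasFDerivAt (fun u => (l : ℂ) * F u)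
        (wirtinger (l * h u) (l * (-conj (u ^ 2 * h u)))) u := by
      refine ((hF u hu).const_mul (l : ℂ)).congr_fderiv ?_
      ext w; simp; ring
    refine ((hq _ (hmem l hl0 hl1 u hu)).comp u h1).congr_fderiv ?_
    rw [wirtinger_comp]
    congr 1
    · simp only [A, N, map_mul, map_neg, conj_conj, conj_ofReal]; ring
    · simp only [c, N, map_mul, map_sub, map_pow, conj_ofReal]; ring
  have hlF : ∀ l : ℝ, 0 ≤ l → l ≤ 1 → ContinuousOn (fun u => a (l * F u)) (ball 0 1) :=
    fun l hl0 hl1 => ha.comp (continuousOn_const.mul hFc) (hmem l hl0 hl1)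
  have hNc : ∀ l : ℝ, 0 ≤ l → l ≤ 1 → ContinuousOn (N l) (ball 0 1) := fun l hl0 hl1 u hu =>
    (hN l hl0 hl1 u hu).continuousAt.continuousWithinAt
  have hcc : ∀ l : ℝ, 0 ≤ l → l ≤ 1 → ContinuousOn (c l) (ball 0 1) := by
    intro l hl0 hl1
    have h1 := hlF l hl0 hl1
    have h2 := hNc l hl0 hl1
    have h3 := continuous_conj.comp_continuousOn hh
    have h4 := continuous_conj.comp_continuousOn h2
    exact ((continuousOn_const.mul h1).mul h3).mul (h4.add continuous_conj.continuousOn)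
  have hAc : ∀ l : ℝ, 0 ≤ l → l ≤ 1 → ContinuousOn (A l) (ball 0 1) := by
    intro l hl0 hl1
    have h1 := hlF l hl0 hl1
    have h4 := continuous_conj.comp_continuousOn (hNc l hl0 hl1)
    exact ((continuousOn_const.mul h1).mul hh).mul
      (continuousOn_const.sub ((h4.pow 2).mul (continuousOn_id.pow 2)))
  have hN1 : ∀ l : ℝ, 0 ≤ l → l ≤ 1 → ∀ u ∈ ball (0 : ℂ) 1, ‖N l u‖ < 1 := fun l hl0 hl1 u hu =>
    hq1 _ (hmem l hl0 hl1 u hu)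
  have hNt : ∀ l, N l t = t := fun l => by simp [N, hFt, hqt]
  have huniq : ∀ l : ℝ, 0 ≤ l → l < 1 → ∀ u ∈ ball (0 : ℂ) 1, N l u = u → u = t := by
    intro l hl0 hl1 u hu hNu
    obtain ⟨z0, hz0, hz0max⟩ := (isCompact_closedBall (0 : ℂ) l).exists_isMaxOn
      ⟨0, by simp [hl0]⟩ ((hqc.mono (closedBall_subset_ball hl1)).norm)
    refine fixedPoint_unique (ρ := ‖q z0‖) (hq1 z0 (closedBall_subset_ball hl1 hz0))
      (hN l hl0 hl1.le) ?_ ?_ (hcc l hl0 hl1.le) ?_ ht hu (hNt l) hNu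
    · have h4 : ContinuousOn (fun u => conj (N l u - u)) (ball 0 1) :=
        continuous_conj.comp_continuousOn ((hNc l hl0 hl1.le).sub continuousOn_id)
      have h5 := (hAc l hl0 hl1.le).prodMk ((hcc l hl0 hl1.le).mul h4)
      exact continuous_wirtinger.comp_continuousOn h5
    · intro v hv
      refine hz0max (a := l * F v) ?_
      have := hF1 v hv
      simp only [mem_closedBall_zero_iff, norm_mul, norm_real, Real.norm_eq_abs, abs_of_nonneg hl0]
      nlinarith [norm_nonneg (F v)]
    · intro v hv
      rw [dbar_wirtinger]
  obtain ⟨ρ, hρ, hρ1⟩ : ∃ ρ, max ‖t‖ ‖u1‖ < ρ ∧ ρ < 1 :=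
    exists_between (max_lt (by simpa using ht) (by simpa using hu1))
  rw [max_lt_iff] at hρ
  have hsub : closedBall (0 : ℂ) ρ ⊆ ball 0 1 := closedBall_subset_ball hρ1
  have hsub' : ball (0 : ℂ) ρ ⊆ ball 0 1 := ball_subset_closedBall.trans hsub
  have hρ0 : 0 < ρ := (norm_nonneg t).trans_lt hρ.1
  obtain ⟨Ch, hCh⟩ := (isCompact_closedBall (0 : ℂ) ρ).exists_bound_of_continuousOn (hh.mono hsub)
  obtain ⟨v0, hv0, hv0max⟩ := (isCompact_closedBall (0 : ℂ) ρ).exists_isMaxOn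
      ⟨0, by simp [hρ0.le]⟩ ((hFc.mono hsub).norm)
  obtain ⟨Ca, hCa⟩ := (isCompact_closedBall (0 : ℂ) ‖F v0‖).exists_bound_of_continuousOn
    (ha.mono (closedBall_subset_ball (hF1 v0 (hsub hv0))))
  have hCh0 : 0 ≤ Ch := (norm_nonneg _).trans (hCh 0 (by simp [hρ0.le]))
  have hCa0 : 0 ≤ Ca := (norm_nonneg _).trans (hCa 0 (by simp))
  have hcC : ∀ l : ℝ, 0 ≤ l → l ≤ 1 → ∀ u ∈ ball (0 : ℂ) ρ, ‖c l u‖ ≤ 1 * Ca * Ch * (1 + 1) := by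
    intro l hl0 hl1 u hu
    have hu' := ball_subset_closedBall hu
    simp only [c, norm_mul, RCLike.norm_conj]
    have h1 : ‖(l : ℂ)‖ ≤ 1 := by simpa [abs_of_nonneg hl0] using hl1
    have h2 : ‖a (l * F u)‖ ≤ Ca := by
      apply hCa
      have h3 : ‖F u‖ ≤ ‖F v0‖ := hv0max hu'
      rw [mem_closedBall_zero_iff, norm_mul]
      calc _ ≤ 1 * ‖F v0‖ := mul_le_mul h1 h3 (norm_nonneg _) zero_le_one
        _ = _ := one_mul _
    have h3 := hCh u hu'
    have h4 : ‖conj (N l u) + conj u‖ ≤ 1 + 1 := by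
      refine (norm_add_le _ _).trans (add_le_add ?_ ?_)
      · rw [RCLike.norm_conj]; exact (hN1 l hl0 hl1 u (hsub' hu)).le
      · rw [RCLike.norm_conj]; exact le_of_lt (by simpa using hsub' hu)
    gcongr
  obtain ⟨M, hM⟩ := exists_similarity (1 * Ca * Ch * (1 + 1)) ρ
  let δ : ℝ → ℂ → ℂ := fun l u => N l u - u
  have hδ : ∀ l : ℝ, 0 ≤ l → l ≤ 1 → ∀ u ∈ ball (0 : ℂ) 1,
      HasFDerivAt (δ l) (wirtinger (A l u - 1) (c l u * conj (δ l u))) u := by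
    intro l hl0 hl1 u hu
    refine ((hN l hl0 hl1 u hu).sub (hasFDerivAt_id u)).congr_fderiv ?_
    ext w; simp [δ]; ring
  have hsim : ∀ l : ℝ, 0 ≤ l → l ≤ 1 → ∃ s : ℂ → ℂ, Continuous s ∧ (∀ z, ‖s z‖ ≤ M) ∧
      DifferentiableOn ℂ (fun u => Complex.exp (-s u) * δ l u) (ball 0 ρ) := by
    intro l hl0 hl1
    have hδc : ContinuousOn (δ l) (ball 0 ρ) :=
      ((hNc l hl0 hl1).mono hsub').sub continuousOn_id
    let β : ℂ → ℂ := (ball (0 : ℂ) ρ).indicator fun u =>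
      dbar (fderiv ℝ (δ l) u) / (ball (0 : ℂ) ρ).indicator (δ l) u
    have hβ : ∀ u ∈ ball (0 : ℂ) ρ, β u = c l u * conj (δ l u) / δ l u := by
      intro u hu
      simp only [β]
      rw [indicator_of_mem hu, indicator_of_mem hu, (hδ l hl0 hl1 u (hsub' hu)).fderiv,
        dbar_wirtinger]
    have hβm : Measurable β := by
      refine Measurable.indicator ?_ measurableSet_ball
      refine (continuous_dbar.measurable.comp (measurable_fderiv ℝ (δ l))).div ?_
      classical
      have h1 : (ball (0 : ℂ) ρ).indicator (δ l) = (ball (0 : ℂ) ρ).piecewise (δ l) 0 :=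
        (piecewise_eq_indicator).symm
      rw [h1]
      exact hδc.measurable_piecewise continuousOn_const measurableSet_ball
    have hβC : ∀ u, ‖β u‖ ≤ 1 * Ca * Ch * (1 + 1) := by
      intro u
      by_cases hu : u ∈ ball (0 : ℂ) ρ
      · rw [hβ u hu, mul_div_assoc, norm_mul, norm_div, RCLike.norm_conj]
        have h1 := hcC l hl0 hl1 u hu
        calc _ ≤ (1 * Ca * Ch * (1 + 1)) * 1 :=
            mul_le_mul h1 (div_self_le_one _) (by positivity) (by positivity)
          _ = _ := mul_one _
      · simp only [β]; rw [indicator_of_notMem hu, norm_zero]; positivity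
    have hβ0 : ∀ u, ρ < ‖u‖ → β u = 0 := by
      intro u hu
      simp only [β]
      rw [indicator_of_notMem (by simpa using hu.le)]
    obtain ⟨s, hs, hsM, hhol⟩ := hM β hβm hβC hβ0
    refine ⟨s, hs, hsM, hhol 0 ρ (δ l) _ (fun u hu => hδ l hl0 hl1 u (hsub' hu)) ?_⟩
    intro u hu
    rw [dbar_wirtinger, hβ u hu]
    by_cases h0 : δ l u = 0
    · simp [h0]
    · rw [div_mul_cancel₀ _ h0]
  have htρ : t ∈ ball (0 : ℂ) ρ := by simpa using hρ.1
  obtain ⟨κ, hκ, hκB, hκne⟩ : ∃ κ > 0, closedBall t κ ⊆ ball 0 ρ ∧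
      ∀ u ∈ sphere t κ, δ 1 u ≠ 0 := by
    obtain ⟨s, hs, hsM, hhol⟩ := hsim 1 zero_le_one le_rfl
    have han := hhol.analyticOnNhd isOpen_ball
    have hev : ∀ᶠ u in 𝓝[≠] t, Complex.exp (-s u) * δ 1 u ≠ 0 := by
      rcases (han t htρ).eventually_eq_zero_or_eventually_ne_zero with h0 | h0
      · exfalso
        have h1 := han.eqOn_zero_of_preconnected_of_eventuallyEq_zero
          (convex_ball (0 : ℂ) ρ).isPreconnected htρ h0
        have h2 := h1 (show u1 ∈ ball (0 : ℂ) ρ by simpa using hρ.2)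
        simp only [Pi.zero_apply, mul_eq_zero, Complex.exp_ne_zero, false_or] at h2
        exact hne (by simpa [δ, N, sub_eq_zero] using h2)
      · exact h0
    rw [eventually_nhdsWithin_iff, Metric.eventually_nhds_iff_ball] at hev
    obtain ⟨κ1, hκ1, hev⟩ := hev
    obtain ⟨κ2, hκ2, hball⟩ := Metric.isOpen_iff.1 isOpen_ball t htρ
    obtain ⟨κ, hκ0, hκ⟩ := exists_between (lt_min hκ1 hκ2)
    rw [lt_min_iff] at hκ
    refine ⟨κ, hκ0, (closedBall_subset_ball hκ.2).trans hball, fun u hu => ?_⟩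
    have h3 := hev u (sphere_subset_ball hκ.1 hu) (by
      rintro rfl
      simp at hu; linarith)
    exact right_ne_zero_of_mul h3
  have hδc : ∀ l : ℝ, 0 ≤ l → l ≤ 1 → ContinuousOn (δ l) (ball 0 1) := fun l hl0 hl1 =>
    (hNc l hl0 hl1).sub continuousOn_id
  have hsph : sphere t κ ⊆ ball (0 : ℂ) 1 := (sphere_subset_closedBall.trans hκB).trans hsub'
  obtain ⟨w0, hw0, hw0min⟩ := (isCompact_sphere t κ).exists_isMinOn
    (NormedSpace.sphere_nonempty.2 hκ.le) ((hδc 1 zero_le_one le_rfl).mono hsph).norm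
  obtain ⟨η, hη0, hη⟩ := exists_between (norm_pos_iff.2 (hκne w0 hw0))
  have hev1 : ∀ᶠ l : ℝ in 𝓝 1, ∀ u ∈ sphere t κ, η < ‖δ l u‖ := by
    refine (isCompact_sphere t κ).eventually_forall_of_forall_eventually fun u hu => ?_
    have hu1 := hsph hu
    have hFu : F u ∈ ball (0 : ℂ) 1 := by simpa using hF1 u hu1
    have h1 : ContinuousAt (fun p : ℝ × ℂ => (p.1 : ℂ) * F p.2) (1, u) :=
      (Complex.continuous_ofReal.continuousAt.comp continuousAt_fst).mul
        ((hF u hu1).continuousAt.comp continuousAt_snd)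
    have h2 : ContinuousAt (fun p : ℝ × ℂ => ‖δ p.1 p.2‖) (1, u) := by
      refine (ContinuousAt.sub ?_ continuousAt_snd).norm
      exact (hq _ hFu).continuousAt.comp_of_eq h1 (by simp)
    refine h2.eventually_const_lt ?_
    exact hη.trans_le (hw0min hu)
  have hev2 : ∀ᶠ l : ℝ in 𝓝 1, (1 - l) * (rexp M * (κ * (rexp M / η))) < 1 := by
    have h1 : Continuous fun l : ℝ => (1 - l) * (rexp M * (κ * (rexp M / η))) := by fun_prop
    exact h1.continuousAt.eventually_lt_const (by simp)
  have hev3 : ∀ᶠ l : ℝ in 𝓝[<] 1, l ∈ Ioo (0 : ℝ) 1 := Ioo_mem_nhdsLT zero_lt_one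
  obtain ⟨l, ⟨hl1, hl2⟩, hl0, hl⟩ :=
    (((hev1.and hev2).filter_mono nhdsWithin_le_nhds).and hev3).exists
  obtain ⟨s, hs, hsM, hhol⟩ := hsim l hl0.le hl.le
  set φ : ℂ → ℂ := fun u => Complex.exp (-s u) * δ l u with hφdef
  have hδt : δ l t = 0 := by simp [δ, hNt]
  have hφt : φ t = 0 := by simp [φ, hδt]
  have hδderiv : HasDerivAt (δ l) (l - 1) t := by
    refine hasDerivAt_of_wirtinger_zero ((hδ l hl0.le hl.le t ht).congr_fderiv ?_)
    congr 1
    · simp only [A]; rw [hNt, hFt, mul_zero]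
      linear_combination (l : ℂ) * hnorm
    · simp [hδt]
  have hφderiv : HasDerivAt φ (Complex.exp (-s t) * (l - 1)) t := by
    rw [hasDerivAt_iff_tendsto_slope] at hδderiv ⊢
    have h1 : Tendsto (fun u => Complex.exp (-s u)) (𝓝[≠] t) (𝓝 (Complex.exp (-s t))) :=
      (hs.neg.cexp.continuousAt).tendsto.mono_left nhdsWithin_le_nhds
    refine (h1.mul hδderiv).congr fun u => ?_
    simp only [slope_def_field, hδt, sub_zero, φ]
    ring
  have hexpM : ∀ z, rexp (-M) ≤ ‖Complex.exp (-s z)‖ := by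
    intro z
    rw [Complex.norm_exp, Real.exp_le_exp, neg_re]
    have := (abs_re_le_norm (s z)).trans (hsM z)
    have := le_abs_self (s z).re
    linarith
  have hψd : DifferentiableOn ℂ (dslope φ t) (ball 0 ρ) :=
    (Complex.differentiableOn_dslope (isOpen_ball.mem_nhds htρ)).2 hhol
  have hψt : dslope φ t t = Complex.exp (-s t) * (l - 1) := by
    rw [dslope_same, hφderiv.deriv]
  have hl1' : (l : ℂ) - 1 ≠ 0 := by
    rw [sub_ne_zero]; exact_mod_cast hl.ne
  have hψ0 : ∀ u ∈ ball (0 : ℂ) ρ, dslope φ t u ≠ 0 := by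
    intro u hu
    by_cases hut : u = t
    · rw [hut, hψt]
      exact mul_ne_zero (Complex.exp_ne_zero _) hl1'
    · rw [dslope_of_ne _ hut, slope_def_field, hφt, sub_zero]
      refine div_ne_zero (mul_ne_zero (Complex.exp_ne_zero _) fun h0 => hut ?_)
        (sub_ne_zero.2 hut)
      exact huniq l hl0.le hl u (hsub' hu) (sub_eq_zero.1 h0)
  have hmax := Complex.norm_le_of_forall_mem_frontier_norm_le (f := fun u => (dslope φ t u)⁻¹)
    (U := ball t κ) (C := κ * (rexp M / η)) isBounded_ball ?_ ?_ (subset_closure (mem_ball_self hκ))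
  · have h1 : ‖dslope φ t t‖ = ‖Complex.exp (-s t)‖ * (1 - l) := by
      rw [hψt, norm_mul]
      congr 1
      have : (l : ℂ) - 1 = ((l - 1 : ℝ) : ℂ) := by push_cast; ring
      rw [this, norm_real, Real.norm_eq_abs, abs_of_neg (by linarith)]; ring
    have h2 : ‖Complex.exp (-s t)‖ ≤ rexp M :=
      (Complex.norm_exp_le_exp_norm _).trans (Real.exp_le_exp.2 (by rw [norm_neg]; exact hsM t))
    have h3 : 0 < ‖dslope φ t t‖ := norm_pos_iff.2 (hψ0 t htρ)
    rw [norm_inv, inv_le_iff_one_le_mul₀ h3, h1] at hmax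
    have h4 : 0 ≤ κ * (rexp M / η) := by positivity
    have h5 : 0 < 1 - l := by linarith
    have h6 : κ * (rexp M / η) * (‖Complex.exp (-s t)‖ * (1 - l)) ≤
        κ * (rexp M / η) * (rexp M * (1 - l)) := by gcongr
    nlinarith
  · refine DifferentiableOn.diffContOnCl ?_
    rw [closure_ball t hκ.ne']
    exact (hψd.mono hκB).inv fun u hu => hψ0 u (hκB hu)
  · intro u hu
    rw [frontier_ball t hκ.ne'] at hu
    have hut : u ≠ t := by
      rintro rfl
      simp at hu; linarith
    have h1 : ‖u - t‖ = κ := by simpa [dist_eq_norm] using hu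
    have h2 := hl1 u hu
    rw [dslope_of_ne _ hut, slope_def_field, hφt, sub_zero, norm_inv, norm_div, h1, inv_div,
      div_eq_mul_inv]
    refine mul_le_mul_of_nonneg_left ?_ hκ.le
    rw [inv_le_comm₀ (norm_pos_iff.2 (mul_ne_zero (Complex.exp_ne_zero _)
      (norm_pos_iff.1 (hη0.trans h2)))) (by positivity), inv_div, div_eq_mul_inv, ← Real.exp_neg,
      mul_comm, norm_mul]
    exact mul_le_mul (hexpM u) h2.le hη0.le (norm_nonneg _)

end FixedPoint

section GaussMap

open Metric Set Filter Topology Complex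
open scoped ComplexConjugate

lemma isOpen_unitDisk : IsOpen unitDisk :=
  isOpen_lt (by fun_prop) continuous_const

lemma pu_eq_fderiv {g : ℝ × ℝ → ℝ} {p : ℝ × ℝ} (hg : DifferentiableAt ℝ g p) :
    pu g p = fderiv ℝ g p (1, 0) := by
  have h1 : HasDerivAt (fun u : ℝ => (u, p.2)) ((1 : ℝ), (0 : ℝ)) p.1 :=
    (hasDerivAt_id p.1).prodMk (hasDerivAt_const p.1 p.2)
  exact (HasFDerivAt.comp_hasDerivAt p.1 hg.hasFDerivAt h1).deriv

lemma pv_eq_fderiv {g : ℝ × ℝ → ℝ} {p : ℝ × ℝ} (hg : DifferentiableAt ℝ g p) :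
    pv g p = fderiv ℝ g p (0, 1) := by
  have h1 : HasDerivAt (fun v : ℝ => (p.1, v)) ((0 : ℝ), (1 : ℝ)) p.2 :=
    (hasDerivAt_const p.2 p.1).prodMk (hasDerivAt_id p.2)
  exact (HasFDerivAt.comp_hasDerivAt p.2 hg.hasFDerivAt h1).deriv

lemma fderiv_apply_eq {g : ℝ × ℝ → ℝ} {p : ℝ × ℝ} (hg : DifferentiableAt ℝ g p) (w : ℝ × ℝ) :
    fderiv ℝ g p w = pu g p * w.1 + pv g p * w.2 := by
  rw [pu_eq_fderiv hg, pv_eq_fderiv hg]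
  have : w = w.1 • ((1 : ℝ), (0 : ℝ)) + w.2 • ((0 : ℝ), (1 : ℝ)) := by ext <;> simp
  conv_lhs => rw [this]
  rw [map_add, map_smul, map_smul, smul_eq_mul, smul_eq_mul, mul_comm, mul_comm w.2]

lemma contDiffOn_pu {n : ℕ} {g : ℝ × ℝ → ℝ} (hg : ContDiffOn ℝ (n + 1) g unitDisk) :
    ContDiffOn ℝ n (pu g) unitDisk := by
  have h1 : ContDiffOn ℝ n (fderiv ℝ g) unitDisk := hg.fderiv_of_isOpen isOpen_unitDisk le_rfl
  refine (h1.clm_apply contDiffOn_const).congr fun p hp => pu_eq_fderiv ?_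
  exact (hg.contDiffAt (isOpen_unitDisk.mem_nhds hp)).differentiableAt (by simp)

lemma contDiffOn_pv {n : ℕ} {g : ℝ × ℝ → ℝ} (hg : ContDiffOn ℝ (n + 1) g unitDisk) :
    ContDiffOn ℝ n (pv g) unitDisk := by
  have h1 : ContDiffOn ℝ n (fderiv ℝ g) unitDisk := hg.fderiv_of_isOpen isOpen_unitDisk le_rfl
  refine (h1.clm_apply contDiffOn_const).congr fun p hp => pv_eq_fderiv ?_
  exact (hg.contDiffAt (isOpen_unitDisk.mem_nhds hp)).differentiableAt (by simp)

lemma pu_pv_eq_pv_pu {g : ℝ × ℝ → ℝ} (hg : ContDiffOn ℝ 2 g unitDisk) {p : ℝ × ℝ}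
    (hp : p ∈ unitDisk) : pu (pv g) p = pv (pu g) p := by
  have hnhds := isOpen_unitDisk.mem_nhds hp
  have hd : ∀ x ∈ unitDisk, DifferentiableAt ℝ g x := fun x hx =>
    (hg.contDiffAt (isOpen_unitDisk.mem_nhds hx)).differentiableAt (by simp)
  have h1 : ContDiffOn ℝ 1 (fderiv ℝ g) unitDisk :=
    hg.fderiv_of_isOpen isOpen_unitDisk (by norm_num)
  have h2 : DifferentiableAt ℝ (fderiv ℝ g) p := (h1.contDiffAt hnhds).differentiableAt (by simp)
  have hu : pu g =ᶠ[𝓝 p] fun x => fderiv ℝ g x (1, 0) := by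
    filter_upwards [hnhds] with x hx using pu_eq_fderiv (hd x hx)
  have hv : pv g =ᶠ[𝓝 p] fun x => fderiv ℝ g x (0, 1) := by
    filter_upwards [hnhds] with x hx using pv_eq_fderiv (hd x hx)
  have h3 : ∀ w : ℝ × ℝ, HasFDerivAt (fun x => fderiv ℝ g x w)
      ((fderiv ℝ (fderiv ℝ g) p).flip w) p := fun w => by
    simpa using h2.hasFDerivAt.clm_apply (hasFDerivAt_const w p)
  have hu' := (h3 (1, 0)).congr_of_eventuallyEq hu
  have hv' := (h3 (0, 1)).congr_of_eventuallyEq hv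
  rw [pu_eq_fderiv hv'.differentiableAt, pv_eq_fderiv hu'.differentiableAt, hv'.fderiv, hu'.fderiv]
  exact (hg.contDiffAt hnhds).isSymmSndFDerivAt (by simp) _ _

/-- The gradient of `f`, as a complex function `f_u - i f_v` on the complex plane. -/
noncomputable def complexGradient (f : ℝ × ℝ → ℝ) (z : ℂ) : ℂ :=
  ⟨pu f (z.re, z.im), -pv f (z.re, z.im)⟩

lemma mem_unitDisk_of_mem_ball {z : ℂ} (hz : z ∈ ball (0 : ℂ) 1) : (z.re, z.im) ∈ unitDisk := by
  have h1 : ‖z‖ < 1 := by simpa using hz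
  have h2 : ‖z‖ ^ 2 = z.re ^ 2 + z.im ^ 2 := by rw [Complex.sq_norm, normSq_apply]; ring
  change z.re ^ 2 + z.im ^ 2 < 1
  nlinarith [norm_nonneg z]

lemma hasFDerivAt_complexGradient {f : ℝ × ℝ → ℝ} (hf : ContDiffOn ℝ 2 f unitDisk) {z : ℂ}
    (hz : z ∈ ball (0 : ℂ) 1) :
    HasFDerivAt (complexGradient f)
      (wirtinger (⟨(pu (pu f) (z.re, z.im) - pv (pv f) (z.re, z.im)) / 2, -pv (pu f) (z.re, z.im)⟩)
        ((pu (pu f) (z.re, z.im) + pv (pv f) (z.re, z.im)) / 2 : ℝ)) z := by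
  have hp := mem_unitDisk_of_mem_ball hz
  have hdu : DifferentiableAt ℝ (pu f) (z.re, z.im) :=
    ((contDiffOn_pu (n := 1) hf).contDiffAt (isOpen_unitDisk.mem_nhds hp)).differentiableAt (by simp)
  have hdv : DifferentiableAt ℝ (pv f) (z.re, z.im) :=
    ((contDiffOn_pv (n := 1) hf).contDiffAt (isOpen_unitDisk.mem_nhds hp)).differentiableAt (by simp)
  have he : HasFDerivAt (fun z : ℂ => (z.re, z.im)) (reCLM.prod imCLM) z :=
    reCLM.hasFDerivAt.prodMk imCLM.hasFDerivAt
  have h1 := (hdu.hasFDerivAt.comp z he)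
  have h2 := (hdv.hasFDerivAt.comp z he)
  have h3 := (ofRealCLM.hasFDerivAt.comp z h1).sub ((ofRealCLM.hasFDerivAt.comp z h2).mul_const I)
  refine (h3.congr_of_eventuallyEq (Eventually.of_forall fun w => ?_)).congr_fderiv ?_
  · apply Complex.ext <;> simp [complexGradient]
  · ext w
    have e1 := fderiv_apply_eq hdu (w.re, w.im)
    have e2 := fderiv_apply_eq hdv (w.re, w.im)
    rw [pu_pv_eq_pv_pu hf hp] at e2
    apply Complex.ext <;> simp [e1, e2] <;> ring

end GaussMap

section GaussMapBeltrami

open Metric Set Filter Topology Complex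
open scoped ComplexConjugate

/-- `√(1 + |g|²)` -/
noncomputable def areaFactor (g : ℂ) : ℝ := √(1 + normSq g)

lemma areaFactor_sq (g : ℂ) : areaFactor g ^ 2 = 1 + normSq g :=
  Real.sq_sqrt (by linarith [normSq_nonneg g])

lemma areaFactor_pos (g : ℂ) : 0 < areaFactor g :=
  Real.sqrt_pos.2 (by linarith [normSq_nonneg g])

lemma ofReal_areaFactor_sq (g : ℂ) : (areaFactor g : ℂ) ^ 2 = 1 + g * conj g := by
  rw [← ofReal_pow, areaFactor_sq, mul_conj]; push_cast; ring

lemma continuous_areaFactor : Continuous areaFactor := by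
  unfold areaFactor
  exact Real.continuous_sqrt.comp (continuous_const.add continuous_normSq)

/-- The stereographic Gauss map of a graph with complex gradient `g`. -/
noncomputable def gaussMap (g : ℂ) : ℂ := g / (1 + areaFactor g)

/-- The holomorphic derivative of the Gauss map, where the complex gradient is `g` and has
derivative `w ↦ B w + L w̄`. -/
noncomputable def gaussMapDeriv (g B : ℂ) (L : ℝ) : ℂ :=
  ((areaFactor g + 1) ^ 2 * B - g ^ 2 * L) / (2 * areaFactor g * (1 + areaFactor g) ^ 2)

lemma one_add_areaFactor_ne_zero (g : ℂ) : (1 + areaFactor g : ℂ) ≠ 0 := by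
  have := areaFactor_pos g
  exact_mod_cast (by positivity : (1 + areaFactor g) ≠ 0)

lemma ofReal_areaFactor_ne_zero (g : ℂ) : (areaFactor g : ℂ) ≠ 0 := by
  exact_mod_cast (areaFactor_pos g).ne'

lemma sq_norm_gaussMap (g : ℂ) : ‖gaussMap g‖ ^ 2 = (areaFactor g - 1) / (areaFactor g + 1) := by
  have h := areaFactor_pos g
  have h1 : (1 + areaFactor g : ℂ) = ((1 + areaFactor g : ℝ) : ℂ) := by push_cast; ring
  rw [gaussMap, h1, norm_div, div_pow, norm_real, Real.norm_eq_abs, sq_abs, Complex.sq_norm]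
  have h2 := areaFactor_sq g
  field_simp
  linear_combination -(1 + areaFactor g) * h2

lemma norm_gaussMap_lt_one (g : ℂ) : ‖gaussMap g‖ < 1 := by
  have h := areaFactor_pos g
  have h1 := sq_norm_gaussMap g
  have h2 : (areaFactor g - 1) / (areaFactor g + 1) < 1 := by
    rw [div_lt_one (by linarith)]; linarith
  nlinarith [norm_nonneg (gaussMap g)]

lemma hasFDerivAt_gaussMap_comp {G : ℂ → ℂ} {B z : ℂ} {L : ℝ}
    (hG : HasFDerivAt G (wirtinger B L) z)
    (hL : L * (areaFactor (G z) ^ 2 + 1) = (conj (G z) ^ 2 * B).re) :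
    HasFDerivAt (fun w => gaussMap (G w))
      (wirtinger (gaussMapDeriv (G z) B L)
        (conj (gaussMap (G z)) ^ 2 * gaussMapDeriv (G z) B L)) z := by
  have hW0 := ofReal_areaFactor_ne_zero (G z)
  have hW1 := one_add_areaFactor_ne_zero (G z)
  have hW2 := ofReal_areaFactor_sq (G z)
  have hL' : (L : ℂ) * ((areaFactor (G z) : ℂ) ^ 2 + 1) * 2 =
      conj (G z) ^ 2 * B + G z ^ 2 * conj B := by
    have h1 : ((conj (G z) ^ 2 * B).re : ℂ) * 2 = conj (G z) ^ 2 * B + G z ^ 2 * conj B := by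
      have := add_conj (conj (G z) ^ 2 * B)
      simp only [map_mul, map_pow, conj_conj] at this
      rw [this]; push_cast; ring
    rw [← h1, ← hL]; push_cast; ring
  have hGre := reCLM.hasFDerivAt.comp z hG
  have hGim := imCLM.hasFDerivAt.comp z hG
  have hns : HasFDerivAt (fun w => 1 + normSq (G w))
      (((2 * (G z).re) • (reCLM.comp (wirtinger B L)) +
        (2 * (G z).im) • (imCLM.comp (wirtinger B L)) : ℂ →L[ℝ] ℝ)) z := by
    refine (((hGre.mul hGre).add (hGim.mul hGim)).const_add 1).congr_fderiv ?_
    ext w; simp; ring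
  have hinv := ((hasDerivAt_inv (by have := areaFactor_pos (G z); positivity :
    1 + areaFactor (G z) ≠ 0)).comp_hasFDerivAt z
      ((hns.sqrt (by linarith [normSq_nonneg (G z)])).const_add 1))
  have hq := hG.mul (ofRealCLM.hasFDerivAt.comp z hinv)
  refine (hq.congr_of_eventuallyEq (Eventually.of_forall fun w => ?_)).congr_fderiv ?_
  · simp [gaussMap, div_eq_mul_inv, areaFactor]
  · ext w
    have hD : 2 * (G z).re * (B * w + L * conj w).re + 2 * (G z).im * (B * w + L * conj w).im =
        (conj (G z) * (B * w + L * conj w) + G z * (conj B * conj w + L * w) : ℂ) := by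
      apply Complex.ext <;> simp <;> ring
    have hW : √(1 + normSq (G z)) = areaFactor (G z) := rfl
    simp only [add_apply, smul_apply,
      ContinuousLinearMap.comp_apply, wirtinger_apply, reCLM_apply, imCLM_apply, smul_eq_mul,
      hW, Function.comp_apply, ofRealCLM_apply]
    push_cast
    rw [hD]
    simp only [gaussMap, gaussMapDeriv, map_div₀, map_add, map_one, conj_ofReal]
    generalize (areaFactor (G z) : ℂ) = W at *
    generalize G z = g at *
    generalize conj g = g' at *
    generalize conj B = B' at *
    generalize conj w = w' at *
    field_simp
    linear_combination ((1 + W) ^ 2 * B * w + L * w' * ((1 + W) ^ 2 - (g * g' + W ^ 2 - 1))) * hW2 +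
      (1 + W) ^ 2 * w' * hL'

lemma sq_norm_gaussMapDeriv {g B : ℂ} {L : ℝ}
    (hL : L * (areaFactor g ^ 2 + 1) = (conj g ^ 2 * B).re) :
    ‖gaussMapDeriv g B L‖ ^ 2 = (normSq B - L ^ 2) / (4 * areaFactor g ^ 2) := by
  have h := areaFactor_pos g
  have h1 : (2 * areaFactor g * (1 + areaFactor g) ^ 2 : ℂ) =
      ((2 * areaFactor g * (1 + areaFactor g) ^ 2 : ℝ) : ℂ) := by push_cast; ring
  have hW := areaFactor_sq g
  have h2 : normSq (((areaFactor g : ℂ) + 1) ^ 2 * B - g ^ 2 * L) =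
      (1 + areaFactor g) ^ 4 * (normSq B - L ^ 2) := by
    have h3 : (((areaFactor g : ℂ) + 1) ^ 2 * B - g ^ 2 * L) =
      (((areaFactor g + 1 : ℝ) ^ 2 : ℝ) : ℂ) * B - g ^ 2 * L := by push_cast; ring
    rw [h3]
    have h4 : (conj g ^ 2 * B).re = (g.re ^ 2 - g.im ^ 2) * B.re + 2 * g.re * g.im * B.im := by
      simp [pow_two]; ring
    rw [h4] at hL
    simp only [normSq_apply, sub_re, sub_im, mul_re, mul_im, ofReal_re, ofReal_im, pow_two] at *
    generalize areaFactor g = W at *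
    have h5 : (g.re ^2 + g.im ^ 2) ^ 2 = (W ^ 2 - 1) ^ 2 := by
      congr 1; linear_combination - hW
    linear_combination (L * L) * h5 + 2 * (W + 1) ^ 2 * L * hL
  rw [gaussMapDeriv, h1, norm_div, div_pow, norm_real, Real.norm_eq_abs, sq_abs, Complex.sq_norm, h2]
  field_simp
  ring

/-- The Gauss map of a minimal graph, in the graph coordinate, solves a Beltrami-type equation,
and its derivative at the origin computes the Gaussian curvature there. -/
theorem IsMinimalGraph.exists_beltrami {f : ℝ × ℝ → ℝ} (hf : IsMinimalGraph f) :
    ∃ q a : ℂ → ℂ,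
      (∀ z ∈ ball (0 : ℂ) 1, HasFDerivAt q (wirtinger (a z) (conj (q z) ^ 2 * a z)) z) ∧
      ContinuousOn a (ball 0 1) ∧ (∀ z, ‖q z‖ < 1) ∧
      |pu (pu f) (0, 0) * pv (pv f) (0, 0) - (pv (pu f) (0, 0)) ^ 2| /
          (1 + (pu f (0, 0)) ^ 2 + (pv f (0, 0)) ^ 2) ^ 2 =
        4 * ‖a 0‖ ^ 2 * ((1 - ‖q 0‖ ^ 2) / (1 + ‖q 0‖ ^ 2)) ^ 2 := by
  obtain ⟨hC, hmse⟩ := hf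
  set B : ℂ → ℂ := fun z =>
    ⟨(pu (pu f) (z.re, z.im) - pv (pv f) (z.re, z.im)) / 2, -pv (pu f) (z.re, z.im)⟩ with hB
  set L : ℂ → ℝ := fun z => (pu (pu f) (z.re, z.im) + pv (pv f) (z.re, z.im)) / 2 with hL
  have hns : ∀ z, normSq (complexGradient f z) =
      pu f (z.re, z.im) ^ 2 + pv f (z.re, z.im) ^ 2 := by
    intro z; simp [complexGradient, normSq_apply]; ring
  have hMSE : ∀ z ∈ ball (0 : ℂ) 1, L z * (areaFactor (complexGradient f z) ^ 2 + 1) =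
      (conj (complexGradient f z) ^ 2 * B z).re := by
    intro z hz
    have h1 := hmse _ (mem_unitDisk_of_mem_ball hz)
    rw [areaFactor_sq, hns]
    simp only [complexGradient, B, L, pow_two, mul_re, mul_im, conj_re, conj_im]
    linear_combination h1
  have hGc : ContinuousOn (complexGradient f) (ball 0 1) := fun z hz =>
    (hasFDerivAt_complexGradient hC hz).continuousAt.continuousWithinAt
  have he : ContinuousOn (fun z : ℂ => (z.re, z.im)) (ball 0 1) :=
    (continuous_re.prodMk continuous_im).continuousOn
  have hmaps : MapsTo (fun z : ℂ => (z.re, z.im)) (ball 0 1) unitDisk := fun z hz =>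
    mem_unitDisk_of_mem_ball hz
  have huu : ContinuousOn (fun z : ℂ => pu (pu f) (z.re, z.im)) (ball 0 1) :=
    (contDiffOn_pu (n := 0) (contDiffOn_pu (n := 1) hC)).continuousOn.comp he hmaps
  have huv : ContinuousOn (fun z : ℂ => pv (pu f) (z.re, z.im)) (ball 0 1) :=
    (contDiffOn_pv (n := 0) (contDiffOn_pu (n := 1) hC)).continuousOn.comp he hmaps
  have hvv : ContinuousOn (fun z : ℂ => pv (pv f) (z.re, z.im)) (ball 0 1) :=
    (contDiffOn_pv (n := 0) (contDiffOn_pv (n := 1) hC)).continuousOn.comp he hmaps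
  have hLc : ContinuousOn L (ball 0 1) := (huu.add hvv).div_const 2
  have hBc : ContinuousOn B (ball 0 1) := by
    have h1 := (continuous_ofReal.comp_continuousOn ((huu.sub hvv).div_const 2)).sub
      ((continuous_ofReal.comp_continuousOn huv).mul (continuousOn_const (c := I)))
    refine h1.congr fun z _ => ?_
    apply Complex.ext <;> simp [B]
  refine ⟨fun z => gaussMap (complexGradient f z),
    fun z => gaussMapDeriv (complexGradient f z) (B z) (L z), ?_, ?_, ?_, ?_⟩
  · exact fun z hz => hasFDerivAt_gaussMap_comp (hasFDerivAt_complexGradient hC hz) (hMSE z hz)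
  · have hW := continuous_ofReal.comp_continuousOn (continuous_areaFactor.comp_continuousOn hGc)
    have h1 := (((hW.add (continuousOn_const (c := (1 : ℂ)))).pow 2).mul hBc).sub
      ((hGc.pow 2).mul (continuous_ofReal.comp_continuousOn hLc))
    have h2 := ((continuousOn_const (c := (2 : ℂ))).mul hW).mul
      (((continuousOn_const (c := (1 : ℂ))).add hW).pow 2)
    exact h1.div h2 fun z _ => mul_ne_zero (mul_ne_zero two_ne_zero (ofReal_areaFactor_ne_zero _))
      (pow_ne_zero 2 (one_add_areaFactor_ne_zero _))
  · exact fun z => norm_gaussMap_lt_one _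
  · have h0 : (0 : ℂ) ∈ ball (0 : ℂ) 1 := by simp
    have h1 := sq_norm_gaussMapDeriv (hMSE 0 h0)
    have h2 := sq_norm_gaussMap (complexGradient f 0)
    have h3 := areaFactor_sq (complexGradient f 0)
    have hpos := areaFactor_pos (complexGradient f 0)
    have h4 : normSq (B 0) - L 0 ^ 2 =
        -(pu (pu f) (0, 0) * pv (pv f) (0, 0) - (pv (pu f) (0, 0)) ^ 2) := by
      simp [B, L, normSq_apply]; ring
    have h5 := hns 0
    simp only [zero_re, zero_im] at h5
    rw [h5, ← add_assoc] at h3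
    have h6 : 0 ≤ normSq (B 0) - L 0 ^ 2 := by
      have h7 : normSq (B 0) - L 0 ^ 2 = 4 * areaFactor (complexGradient f 0) ^ 2 *
          ‖gaussMapDeriv (complexGradient f 0) (B 0) (L 0)‖ ^ 2 := by
        rw [h1]; field_simp
      rw [h7]; positivity
    rw [← abs_neg, ← h4, abs_of_nonneg h6, ← h3]
    simp only [h1, h2]
    generalize areaFactor (complexGradient f 0) = W at *
    have : W + 1 ≠ 0 := by positivity
    have h8 : (1 - (W - 1) / (W + 1)) / (1 + (W - 1) / (W + 1)) = 1 / W := by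
      have : 1 + (W - 1) / (W + 1) ≠ 0 := by
        have : 1 + (W - 1) / (W + 1) = 2 * W / (W + 1) := by field_simp; ring
        rw [this]; positivity
      rw [div_eq_div_iff this hpos.ne']
      field_simp; ring
    rw [h8]
    field_simp

end GaussMapBeltrami

section Scherk

open Metric Set Filter Topology Complex
open scoped ComplexConjugate

/-- The angle `arg (1 - u x̄)` under which `u` is seen from the boundary point `x`. -/
noncomputable def boundaryAngle (x u : ℂ) : ℝ := (Complex.log (1 - u * conj x)).im

lemma boundaryAngle_eq_arg (x u : ℂ) : boundaryAngle x u = arg (1 - u * conj x) := log_im _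

lemma re_one_sub_mul_conj_pos {x u : ℂ} (hx : ‖x‖ = 1) (hu : ‖u‖ < 1) :
    0 < (1 - u * conj x).re := by
  have h1 : ‖u * conj x‖ < 1 := by rwa [norm_mul, RCLike.norm_conj, hx, mul_one]
  have h2 := (abs_re_le_norm (u * conj x)).trans_lt h1
  rw [abs_lt] at h2
  rw [sub_re, one_re]; linarith

lemma abs_boundaryAngle_lt {x u : ℂ} (hx : ‖x‖ = 1) (hu : ‖u‖ < 1) :
    |boundaryAngle x u| < π / 2 := by
  rw [boundaryAngle_eq_arg, abs_arg_lt_pi_div_two_iff]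
  exact Or.inl (re_one_sub_mul_conj_pos hx hu)

lemma hasFDerivAt_boundaryAngle {x u : ℂ} (hx : ‖x‖ = 1) (hu : ‖u‖ < 1) :
    HasFDerivAt (fun u => (boundaryAngle x u : ℂ))
      (wirtinger (I / 2 / (x - u)) (conj (I / 2 / (x - u)))) u := by
  have hre := re_one_sub_mul_conj_pos hx hu
  have hxx : x * conj x = 1 := by
    rw [mul_conj, normSq_eq_norm_sq, hx]; norm_num
  have hx0 : x ≠ 0 := by rintro rfl; simp at hx
  have hxu : x - u = x * (1 - u * conj x) := by linear_combination u * hxx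
  have hne : 1 - u * conj x ≠ 0 := fun h => by simp [h] at hre
  have h1 : HasDerivAt (fun u => 1 - u * conj x) (-conj x) u := by
    simpa using ((hasDerivAt_id u).mul_const (conj x)).const_sub 1
  have h2 := (h1.clog (Or.inl hre)).hasFDerivAt.restrictScalars ℝ
  have h3 := ofRealCLM.hasFDerivAt.comp u (imCLM.hasFDerivAt.comp u h2)
  refine h3.congr_fderiv ?_
  have h4 : I / 2 / (x - u) = -I / 2 * (-conj x / (1 - u * conj x)) := by
    have h5 : conj x = x⁻¹ := eq_inv_of_mul_eq_one_right hxx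
    rw [hxu]
    generalize 1 - u * conj x = E
    rw [h5]; ring
  rw [h4]
  generalize -conj x / (1 - u * conj x) = D
  ext w
  apply Complex.ext <;> simp [map_ofNat] <;> ring

/-- For adjacent vertices of an inscribed square the angles differ by more than `-π/4`. -/
lemma boundaryAngle_sub_gt {x u : ℂ} (hx : ‖x‖ = 1) (hu : ‖u‖ < 1) :
    -(π / 4) < boundaryAngle (I * x) u - boundaryAngle x u := by
  have hx' : ‖I * x‖ = 1 := by rw [norm_mul, hx, norm_I, mul_one]
  have b1 := abs_lt.1 (abs_boundaryAngle_lt hx hu)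
  have b2 := abs_lt.1 (abs_boundaryAngle_lt hx' hu)
  have p1 := re_one_sub_mul_conj_pos hx hu
  have p2 := re_one_sub_mul_conj_pos hx' hu
  rw [boundaryAngle_eq_arg] at b1 b2
  rw [boundaryAngle_eq_arg, boundaryAngle_eq_arg]
  set y := u * conj x with hy
  have e2 : 1 - u * conj (I * x) = 1 + I * y := by rw [map_mul, conj_I, hy]; ring
  rw [e2] at b2 p2 ⊢
  have hy1 : ‖y‖ < 1 := by rwa [hy, norm_mul, RCLike.norm_conj, hx, mul_one]
  have hy2 : y.re * y.re + y.im * y.im < 1 := by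
    rw [← normSq_apply, normSq_eq_norm_sq]; nlinarith [norm_nonneg y]
  have n1 : 1 - y ≠ 0 := fun h => by rw [h] at p1; simp at p1
  have n2 : 1 + I * y ≠ 0 := fun h => by rw [h] at p2; simp at p2
  by_contra! hcon
  have hs : Real.sin (arg (1 + I * y) - arg (1 - y) + π / 4) ≤ 0 :=
    Real.sin_nonpos_of_nonpos_of_neg_pi_le (by linarith) (by linarith [Real.pi_pos])
  rw [Real.sin_add, Real.sin_sub, Real.cos_sub, Real.cos_pi_div_four, Real.sin_pi_div_four,
    Complex.cos_arg n1, Complex.cos_arg n2, Complex.sin_arg, Complex.sin_arg] at hs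
  have q1 := norm_pos_iff.2 n1
  have q2 := norm_pos_iff.2 n2
  generalize ‖1 - y‖ = N1 at *
  generalize ‖1 + I * y‖ = N2 at *
  simp only [sub_re, sub_im, add_re, add_im, one_re, one_im, mul_re, mul_im, I_re, I_im] at hs
  have h3 : 0 < (1 - (y.re * y.re + y.im * y.im)) * (√2 / 2) / (N1 * N2) := by
    have : 0 < 1 - (y.re * y.re + y.im * y.im) := by linarith
    positivity
  refine absurd hs (not_le.2 (h3.trans_eq ?_))
  field_simp
  ring

end Scherk

section ScherkMap

open Metric Set Filter Topology Complex
open scoped ComplexConjugate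

/-- The four values, indexed by `x = 1, i, -1, -i`, of the harmonic comparison map. -/
noncomputable def scherkVertex (s x : ℂ) : ℂ :=
  I * (x * (1 - I) / 2 + conj s * x ^ 2 + conj s ^ 2 * x ^ 3 * (1 + I) / 2)

/-- The harmonic measure of the arc from `x` to `i x`. -/
noncomputable def arcMeasure (x u : ℂ) : ℝ :=
  1 / 4 + (boundaryAngle (I * x) u - boundaryAngle x u) / π

/-- The harmonic comparison map onto the quadrilateral with vertices `scherkVertex s x`. -/
noncomputable def scherkMap (s u : ℂ) : ℂ :=
  ∑ k : Fin 4, arcMeasure (I ^ (k : ℕ)) u * scherkVertex s (I ^ (k : ℕ))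

lemma norm_I_pow (k : ℕ) : ‖I ^ k‖ = 1 := by simp

lemma arcMeasure_pos {x u : ℂ} (hx : ‖x‖ = 1) (hu : ‖u‖ < 1) : 0 < arcMeasure x u := by
  have h := boundaryAngle_sub_gt hx hu
  have : -(1 / 4) < (boundaryAngle (I * x) u - boundaryAngle x u) / π := by
    rw [lt_div_iff₀ Real.pi_pos]; linarith
  unfold arcMeasure; linarith

lemma sum_arcMeasure (u : ℂ) : ∑ k : Fin 4, arcMeasure (I ^ (k : ℕ)) u = 1 := by
  simp only [arcMeasure, Fin.sum_univ_four, Fin.val_zero, Fin.val_one, Fin.val_two,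
    Fin.isValue, ← pow_succ', pow_zero]
  have h3 : ((3 : Fin 4) : ℕ) = 3 := rfl
  simp only [h3, zero_add, Nat.reduceAdd, I_pow_four, pow_one]
  ring

lemma scherkMap_eq (s u : ℂ) : scherkMap s u = -(I / π) *
    ((1 + conj s) ^ 2 * boundaryAngle 1 u + I * (1 + conj s * I) ^ 2 * boundaryAngle I u
      - (1 - conj s) ^ 2 * boundaryAngle (-1) u
      - I * (1 - conj s * I) ^ 2 * boundaryAngle (-I) u) := by
  have h3 : ((3 : Fin 4) : ℕ) = 3 := rfl
  simp only [scherkMap, Fin.sum_univ_four, Fin.val_zero, Fin.val_one, Fin.val_two, h3,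
    Fin.isValue, arcMeasure, scherkVertex, I_sq, pow_zero, pow_one, I_pow_three, mul_one,
    I_mul_I, mul_neg, neg_neg]
  push_cast
  have i3 : I ^ 3 = -I := I_pow_three
  have i4 : I ^ 4 = 1 := I_pow_four
  have i5 : I ^ 5 = I := by rw [pow_succ, i4, one_mul]
  ring_nf
  simp only [I_sq, i3, i4, i5]
  ring

lemma I_div_two_div_sub {x u : ℂ} (hx : x ^ 4 = 1) (hu : 1 - u ^ 4 ≠ 0) :
    I / 2 / (x - u) = (I * (x ^ 3 + x ^ 2 * u + x * u ^ 2 + u ^ 3)) / (2 * (1 - u ^ 4)) := by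
  have h : (x - u) * (x ^ 3 + x ^ 2 * u + x * u ^ 2 + u ^ 3) = 1 - u ^ 4 := by
    linear_combination hx
  have h1 : x - u ≠ 0 := fun h0 => hu (by rw [← h, h0, zero_mul])
  field_simp
  linear_combination -h

lemma hasFDerivAt_scherkMap (s : ℂ) {u : ℂ} (hs : 1 + conj s * u ≠ 0) (hu : ‖u‖ < 1) :
    HasFDerivAt (scherkMap s)
      (wirtinger (2 / π * (1 + conj s * u) ^ 2 / (1 - u ^ 4))
        (-conj (((u + s) / (1 + conj s * u)) ^ 2 *
          (2 / π * (1 + conj s * u) ^ 2 / (1 - u ^ 4))))) u := by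
  have hu4 : 1 - u ^ 4 ≠ 0 := fun h => by
    have h1 : ‖u‖ ^ 4 = 1 := by rw [← norm_pow, ← sub_eq_zero.1 h, norm_one]
    exact absurd h1 (pow_lt_one₀ (norm_nonneg u) hu (by norm_num)).ne
  have hu4' : 1 - conj u ^ 4 ≠ 0 := fun h => hu4 ((map_eq_zero (starRingEnd ℂ)).1 (by simpa using h))
  have e1 := I_div_two_div_sub (x := 1) (by norm_num) hu4
  have e2 := I_div_two_div_sub (x := I) I_pow_four hu4
  have e3 := I_div_two_div_sub (x := -1) (by norm_num) hu4
  have e4 := I_div_two_div_sub (x := -I) (by rw [Even.neg_pow (by decide)]; exact I_pow_four) hu4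
  have i4 : I ^ 4 = 1 := I_pow_four
  have i5 : I ^ 5 = I := by rw [pow_succ, i4, one_mul]
  have i6 : I ^ 6 = -1 := by rw [pow_succ, i5, I_mul_I]
  have i7 : I ^ 7 = -I := by rw [pow_succ, i6]; ring
  have i8 : I ^ 8 = 1 := by rw [pow_succ, i7]; rw [neg_mul, I_mul_I, neg_neg]
  have d1 := (hasFDerivAt_boundaryAngle (x := 1) (by simp) hu).const_mul ((1 + conj s) ^ 2)
  have d2 := (hasFDerivAt_boundaryAngle (x := I) (by simp) hu).const_mul (I * (1 + conj s * I) ^ 2)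
  have d3 := (hasFDerivAt_boundaryAngle (x := -1) (by simp) hu).const_mul ((1 - conj s) ^ 2)
  have d4 := (hasFDerivAt_boundaryAngle (x := -I) (by simp) hu).const_mul
    (I * (1 - conj s * I) ^ 2)
  have hd := (((d1.add d2).sub d3).sub d4).const_mul (-(I / π))
  refine (hd.congr_of_eventuallyEq (Eventually.of_forall (scherkMap_eq s))).congr_fderiv ?_
  have hpi : (π : ℂ) ≠ 0 := by exact_mod_cast Real.pi_ne_zero
  have k1 : -(I / π) * ((1 + conj s) ^ 2 * (I / 2 / (1 - u)) +
      I * (1 + conj s * I) ^ 2 * (I / 2 / (I - u)) - (1 - conj s) ^ 2 * (I / 2 / (-1 - u)) -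
      I * (1 - conj s * I) ^ 2 * (I / 2 / (-I - u))) =
      2 / π * (1 + conj s * u) ^ 2 / (1 - u ^ 4) := by
    rw [e1, e2, e3, e4]
    field_simp
    ring_nf
    simp only [I_sq, i4, i6, i8]
    ring
  have k2 : -(I / π) * ((1 + conj s) ^ 2 * conj (I / 2 / (1 - u)) +
      I * (1 + conj s * I) ^ 2 * conj (I / 2 / (I - u)) -
      (1 - conj s) ^ 2 * conj (I / 2 / (-1 - u)) -
      I * (1 - conj s * I) ^ 2 * conj (I / 2 / (-I - u))) =
      -conj (2 / π * (u + s) ^ 2 / (1 - u ^ 4)) := by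
    rw [e1, e2, e3, e4]
    simp only [map_div₀, map_mul, map_add, map_sub, map_pow, map_one, map_neg, conj_I, map_ofNat,
      conj_ofReal]
    field_simp
    ring_nf
    simp only [I_sq, i4, i6, i8]
    ring
  have k3 : ((u + s) / (1 + conj s * u)) ^ 2 * (2 / π * (1 + conj s * u) ^ 2 / (1 - u ^ 4)) =
      2 / π * (u + s) ^ 2 / (1 - u ^ 4) := by
    rw [div_pow]
    generalize 1 + conj s * u = E at hs
    field_simp
  rw [k3, ← k1, ← k2]
  ext w
  simp
  ring

end ScherkMap

section ScherkBounds

open Metric Set Filter Topology Complex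
open scoped ComplexConjugate

lemma norm_wirtinger_le (a b : ℂ) : ‖wirtinger a b‖ ≤ ‖a‖ + ‖b‖ := by
  refine ContinuousLinearMap.opNorm_le_bound _ (by positivity) fun w => ?_
  rw [wirtinger_apply]
  calc _ ≤ ‖a * w‖ + ‖b * conj w‖ := norm_add_le _ _
    _ = _ := by rw [norm_mul, norm_mul, RCLike.norm_conj]; ring

lemma norm_one_add_I : ‖1 + I‖ = √2 := by
  rw [Complex.norm_def, normSq_apply]; norm_num

lemma norm_one_sub_I : ‖1 - I‖ = √2 := by
  rw [Complex.norm_def, normSq_apply]; norm_num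

lemma scherkMap_zero (s : ℂ) : scherkMap s 0 = 0 := by
  rw [scherkMap_eq]; simp [boundaryAngle]

lemma sqrt_two_mul_norm_scherkVertex_le (s : ℂ) {x : ℂ} (hx : ‖x‖ = 1) :
    √2 * ‖scherkVertex s x‖ ≤ 1 + √2 * ‖s‖ + ‖s‖ ^ 2 := by
  have h2 : √2 * √2 = 2 := Real.mul_self_sqrt (by norm_num)
  have h : ‖scherkVertex s x‖ ≤ √2 / 2 + ‖s‖ + ‖s‖ ^ 2 * √2 / 2 := by
    unfold scherkVertex
    rw [norm_mul, norm_I, one_mul]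
    refine (norm_add₃_le).trans_eq ?_
    simp [hx, norm_one_add_I, norm_one_sub_I]
  calc _ ≤ √2 * (√2 / 2 + ‖s‖ + ‖s‖ ^ 2 * √2 / 2) := by gcongr
    _ = _ := by linear_combination (1 / 2 + ‖s‖ ^ 2 / 2) * h2

lemma sqrt_two_mul_norm_scherkMap_le (s : ℂ) {u : ℂ} (hu : ‖u‖ < 1) :
    √2 * ‖scherkMap s u‖ ≤ 1 + √2 * ‖s‖ + ‖s‖ ^ 2 := by
  have h : ‖scherkMap s u‖ ≤ ∑ k : Fin 4, arcMeasure (I ^ (k : ℕ)) u *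
      ((1 + √2 * ‖s‖ + ‖s‖ ^ 2) / √2) := by
    refine norm_sum_le_of_le _ fun k _ => ?_
    have hk := arcMeasure_pos (norm_I_pow k) hu
    rw [norm_mul, norm_real, Real.norm_eq_abs, abs_of_pos hk]
    refine mul_le_mul_of_nonneg_left ?_ hk.le
    rw [le_div_iff₀ (by positivity), mul_comm]
    exact sqrt_two_mul_norm_scherkVertex_le s (norm_I_pow k)
  rw [← Finset.sum_mul, sum_arcMeasure, one_mul, le_div_iff₀ (by positivity)] at h
  linarith

/-- Third-order estimate for the comparison map at the origin. -/
lemma norm_scherkMap_sub_le {u s : ℂ} {b r : ℝ} (hb : b = 2 / π) (hr : ‖u‖ = r) (hr2 : r ≤ 1 / 2)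
    (hs : s = b * u) :
    ‖scherkMap s u - b * u‖ ≤
      b * (16 / 15) * (2 * b + (b ^ 2 + 1) / 4 + (1 + b) ^ 2) * r ^ 2 * r := by
  have hr0 : 0 ≤ r := hr ▸ norm_nonneg u
  have hb0 : 0 < b := by rw [hb]; positivity
  have hb1 : b < 1 := by
    rw [hb, div_lt_one Real.pi_pos]; linarith [Real.pi_gt_three]
  have hbc : (b : ℂ) = 2 / π := by rw [hb]; push_cast; rfl
  have hsn : ‖s‖ = b * r := by rw [hs, norm_mul, norm_real, hr, Real.norm_eq_abs, abs_of_pos hb0]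
  have hball : ∀ v ∈ closedBall (0 : ℂ) r, HasFDerivWithinAt (fun v => scherkMap s v - b * v)
      (wirtinger (b * ((1 + conj s * v) ^ 2 / (1 - v ^ 4) - 1))
        (-conj (b * (v + s) ^ 2 / (1 - v ^ 4)))) (closedBall 0 r) v := by
    intro v hv
    rw [mem_closedBall_zero_iff] at hv
    have hsv : 1 + conj s * v ≠ 0 := fun h => by
      have h1 : ‖conj s * v‖ = 1 := by
        rw [eq_neg_of_add_eq_zero_right h, norm_neg, norm_one]
      rw [norm_mul, RCLike.norm_conj, hsn] at h1
      nlinarith [mul_nonneg hb0.le hr0, norm_nonneg v]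
    have h1 := hasFDerivAt_scherkMap s hsv (by linarith)
    have h2 : HasFDerivAt (fun v : ℂ => (b : ℂ) * v) (wirtinger b 0) v := by
      refine ((hasFDerivAt_id v).const_mul (b : ℂ)).congr_fderiv ?_
      ext w; simp
    refine ((h1.sub h2).congr_fderiv ?_).hasFDerivWithinAt
    have h3 : ((v + s) / (1 + conj s * v)) ^ 2 * (2 / π * (1 + conj s * v) ^ 2 / (1 - v ^ 4)) =
        b * (v + s) ^ 2 / (1 - v ^ 4) := by
      rw [hbc, div_pow]
      generalize 1 + conj s * v = E at hsv
      field_simp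
    rw [h3, hbc]
    ext w; simp; ring
  have hbound : ∀ v ∈ closedBall (0 : ℂ) r,
      ‖wirtinger (b * ((1 + conj s * v) ^ 2 / (1 - v ^ 4) - 1))
        (-conj (b * (v + s) ^ 2 / (1 - v ^ 4)))‖ ≤
      b * (16 / 15) * (2 * b + (b ^ 2 + 1) / 4 + (1 + b) ^ 2) * r ^ 2 := by
    intro v hv
    rw [mem_closedBall_zero_iff] at hv
    have h4 : 15 / 16 ≤ ‖1 - v ^ 4‖ := by
      have h5 := norm_sub_norm_le (1 : ℂ) (v ^ 4)
      rw [norm_one, norm_pow] at h5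
      have : ‖v‖ ^ 4 ≤ (1 / 2) ^ 4 := by gcongr; linarith
      linarith
    have h4' : 1 - v ^ 4 ≠ 0 := norm_pos_iff.1 (by linarith)
    have h6 : ‖(1 + conj s * v) ^ 2 - (1 - v ^ 4)‖ ≤ 2 * b * r ^ 2 + b ^ 2 * r ^ 4 + r ^ 4 := by
      have e : (1 + conj s * v) ^ 2 - (1 - v ^ 4) = 2 * (conj s * v) + (conj s * v) ^ 2 + v ^ 4 := by
        ring
      rw [e]
      refine (norm_add₃_le).trans ?_
      simp only [norm_mul, norm_pow, RCLike.norm_conj, Complex.norm_ofNat, hsn]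
      calc _ ≤ 2 * (b * r * r) + (b * r * r) ^ 2 + r ^ 4 := by gcongr
        _ = _ := by ring
    have h7 : ‖(v + s) ^ 2‖ ≤ ((1 + b) * r) ^ 2 := by
      rw [norm_pow]
      have := norm_add_le v s
      rw [hsn] at this
      gcongr
      linarith
    refine (norm_wirtinger_le _ _).trans ?_
    rw [norm_neg, RCLike.norm_conj, div_sub_one h4', mul_div_assoc, norm_mul, norm_mul, norm_div,
      norm_div, norm_real, Real.norm_eq_abs, abs_of_pos hb0]
    have h8 : ‖(1 + conj s * v) ^ 2 - (1 - v ^ 4)‖ / ‖1 - v ^ 4‖ ≤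
        (2 * b * r ^ 2 + b ^ 2 * r ^ 4 + r ^ 4) / (15 / 16) := by gcongr
    have h9 : ‖(v + s) ^ 2‖ / ‖1 - v ^ 4‖ ≤ ((1 + b) * r) ^ 2 / (15 / 16) := by gcongr
    have h10 : r ^ 4 ≤ r ^ 2 / 4 := by
      have : r ^ 2 ≤ 1 / 4 := by nlinarith
      nlinarith [mul_le_mul_of_nonneg_left this (sq_nonneg r)]
    have h11 : b ^ 2 * r ^ 4 ≤ b ^ 2 * (r ^ 2 / 4) := by gcongr
    calc _ ≤ b * ((2 * b * r ^ 2 + b ^ 2 * r ^ 4 + r ^ 4) / (15 / 16)) +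
          b * (((1 + b) * r) ^ 2 / (15 / 16)) := by gcongr
      _ ≤ b * ((2 * b * r ^ 2 + b ^ 2 * (r ^ 2 / 4) + r ^ 2 / 4) / (15 / 16)) +
          b * (((1 + b) * r) ^ 2 / (15 / 16)) := by gcongr
      _ = _ := by ring
  have h := (convex_closedBall (0 : ℂ) r).norm_image_sub_le_of_norm_hasFDerivWithin_le hball hbound
    (x := 0) (y := u) (by simpa using hr0) (by simp [hr])
  simpa [scherkMap_zero, hr] using h

/-- First-order estimate for the vertices. -/
lemma sqrt_two_mul_norm_scherkVertex_sub_le {u s x : ℂ} {b r : ℝ} (hb0 : 0 < b) (hr : ‖u‖ = r)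
    (hs : s = b * u) (hx : ‖x‖ = 1) :
    √2 * ‖scherkVertex s x - b * u‖ ≤ 1 + 4 * b ^ 2 * r ^ 2 + b ^ 2 * r ^ 2 := by
  have h2 : √2 * √2 = 2 := Real.mul_self_sqrt (by norm_num)
  have h2c : (√2 : ℂ) * √2 = 2 := by exact_mod_cast h2
  have hsn : ‖s‖ = b * r := by rw [hs, norm_mul, norm_real, hr, Real.norm_eq_abs, abs_of_pos hb0]
  set y : ℂ := x * (1 + I) * √2 / 2 with hy
  have hyn : ‖y‖ = 1 := by
    rw [hy]; simp [hx, norm_one_add_I, abs_of_nonneg (Real.sqrt_nonneg 2)]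
  have hyy : y * conj y = 1 := by rw [mul_conj, normSq_eq_norm_sq, hyn]; norm_num
  have hV : √2 * (scherkVertex s x - b * u) =
      y * (1 + √2 * b * (conj u * y - u * conj y)) + I * (conj s ^ 2 * x ^ 3 * (1 + I) * √2 / 2) := by
    have e1 : y * (1 + √2 * b * (conj u * y - u * conj y)) =
        y + √2 * b * (conj u * y ^ 2 - u) := by linear_combination -√2 * b * u * hyy
    have e2 : y ^ 2 = I * x ^ 2 := by
      rw [hy]; linear_combination x ^ 2 * (1 + I) ^ 2 / 4 * h2c + x ^ 2 / 2 * I_sq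
    rw [e1, e2, scherkVertex, hy]
    have e3 : conj s = b * conj u := by rw [hs]; simp
    rw [e3]
    linear_combination -x * √2 / 2 * I_sq
  have h1 : ‖1 + √2 * b * (conj u * y - u * conj y)‖ ≤ 1 + 4 * b ^ 2 * r ^ 2 := by
    have e : conj u * y - u * conj y = ((2 * (conj u * y).im : ℝ) : ℂ) * I := by
      have := sub_conj (conj u * y)
      simpa using this
    have him : |(conj u * y).im| ≤ r := by
      refine (abs_im_le_norm _).trans_eq ?_
      rw [norm_mul, RCLike.norm_conj, hyn, hr, mul_one]
    have him2 : (conj u * y).im ^ 2 ≤ r ^ 2 := sq_le_sq' (abs_le.1 him).1 (abs_le.1 him).2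
    rw [e]
    generalize (conj u * y).im = m at *
    refine abs_le_of_sq_le_sq' ?_ (by positivity) |>.2
    have e5 : (1 + √2 * b * (((2 * m : ℝ) : ℂ) * I) : ℂ) = ⟨1, √2 * b * (2 * m)⟩ := by
      apply Complex.ext <;> simp
    rw [e5, Complex.sq_norm, normSq_mk]
    have : b ^ 2 * m ^ 2 ≤ b ^ 2 * r ^ 2 := by gcongr
    nlinarith [sq_nonneg (b ^ 2 * r ^ 2)]
  have h3 : ‖I * (conj s ^ 2 * x ^ 3 * (1 + I) * √2 / 2)‖ = b ^ 2 * r ^ 2 := by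
    simp only [norm_mul, norm_div, norm_pow, RCLike.norm_conj, norm_I, hx, norm_one_add_I,
      norm_real, Complex.norm_ofNat, hsn, Real.norm_eq_abs, abs_of_nonneg (Real.sqrt_nonneg 2)]
    linear_combination b ^ 2 * r ^ 2 / 2 * h2
  calc √2 * ‖scherkVertex s x - b * u‖ = ‖√2 * (scherkVertex s x - b * u)‖ := by
        rw [norm_mul, norm_real, Real.norm_eq_abs, abs_of_nonneg (Real.sqrt_nonneg 2)]
    _ ≤ _ := by
        rw [hV]
        refine (norm_add_le _ _).trans ?_
        rw [h3, norm_mul, hyn, one_mul]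
        gcongr

lemma scherk_polynomial_bound {X : ℝ} (h1 : 1 / 4 ≤ X) (h2 : X ≤ 1) :
    (2.902 + 1.715 * X) * ((1 - 0.404 * X) * (1 + X * X)) ≤ (1 + 3.948 * X) ^ 2 := by
  have k1 : (2.902 + 1.715 * X) * (1 - 0.404 * X) ≤ 2.902 + 0.543 * X := by
    nlinarith [sq_nonneg X]
  have k2 := mul_le_mul_of_nonneg_right k1 (by nlinarith : 0 ≤ 1 + X * X)
  have k3 : X * X * X ≤ X * X := mul_le_of_le_one_right (mul_self_nonneg X) h2
  nlinarith [mul_nonneg (sub_nonneg.2 h1) (sub_nonneg.2 h1)]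

set_option maxHeartbeats 1000000 in
/-- The vertices of the comparison map, recentred at the value at the base point, are small. -/
theorem norm_scherkVertex_sub_scherkMap_le {u s x : ℂ} {b r : ℝ} (hb : b = 2 / π) (hr : ‖u‖ = r)
    (hr1 : r < 1) (hs : s = b * u) (hx : ‖x‖ = 1) :
    √2 * ‖scherkVertex s x - scherkMap s u‖ * ((1 - b ^ 2 * r ^ 2) * (1 + r ^ 4)) ≤
      ((1 + b * r ^ 2) ^ 2 + (1 + b) ^ 2 * r ^ 2) ^ 2 := by
  have hr0 : 0 ≤ r := hr ▸ norm_nonneg u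
  have hb1 : 0.636 < b := by
    rw [hb, lt_div_iff₀ Real.pi_pos]; linarith [Real.pi_lt_d4]
  have hb2 : b < 0.637 := by
    rw [hb, div_lt_iff₀ Real.pi_pos]; linarith [Real.pi_gt_d4]
  have hb0 : 0 < b := by linarith
  have hs2 : √2 < 1.415 := by
    rw [Real.sqrt_lt' (by norm_num)]; norm_num
  have hb3 : b ^ 2 < 0.406 := by nlinarith
  have hb4 : 0.404 < b ^ 2 := by nlinarith
  have hsn : ‖s‖ = b * r := by rw [hs, norm_mul, norm_real, hr, Real.norm_eq_abs, abs_of_pos hb0]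
  have hP0 : 0 ≤ (1 - b ^ 2 * r ^ 2) * (1 + r ^ 4) := by
    have : b ^ 2 * r ^ 2 ≤ 1 * 1 := by gcongr <;> nlinarith
    have h1 : 0 ≤ 1 - b ^ 2 * r ^ 2 := by linarith
    positivity
  have hM : (1 + 3.948 * r ^ 2) ^ 2 ≤ ((1 + b * r ^ 2) ^ 2 + (1 + b) ^ 2 * r ^ 2) ^ 2 := by
    have e : (1 + b * r ^ 2) ^ 2 + (1 + b) ^ 2 * r ^ 2 =
      1 + (1 + 4 * b + b ^ 2) * r ^ 2 + b ^ 2 * r ^ 4 := by ring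
    rw [e]
    have h2 : 3.948 * r ^ 2 ≤ (1 + 4 * b + b ^ 2) * r ^ 2 := by gcongr; linarith
    have h3 : 0 ≤ b ^ 2 * r ^ 4 := by positivity
    exact pow_le_pow_left₀ (by positivity) (by linarith) 2
  refine le_trans ?_ hM
  rcases le_total r (1 / 2) with h | h
  · have h1 := norm_scherkMap_sub_le hb hr h hs
    have h2 := sqrt_two_mul_norm_scherkVertex_sub_le hb0 hr hs hx
    have h3 : ‖scherkVertex s x - scherkMap s u‖ ≤
        ‖scherkVertex s x - b * u‖ + ‖scherkMap s u - b * u‖ := by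
      refine (norm_sub_le_norm_sub_add_norm_sub _ (b * u) _).trans_eq ?_
      rw [norm_sub_rev (b * u)]
    have h4 : √2 * (b * (16 / 15) * (2 * b + (b ^ 2 + 1) / 4 + (1 + b) ^ 2) * r ^ 2 * r) ≤
        1.415 * (0.637 * (16 / 15) * (2 * 0.637 + (0.406 + 1) / 4 + (1 + 0.637) ^ 2) * r ^ 2 *
          (1 / 2)) := by gcongr
    have h5 : √2 * ‖scherkVertex s x - scherkMap s u‖ ≤ 1 + 4.15 * r ^ 2 := by
      have h6 := mul_le_mul_of_nonneg_left (h3.trans (add_le_add_right h1 _)) (Real.sqrt_nonneg 2)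
      have h7 : b ^ 2 * r ^ 2 ≤ 0.406 * r ^ 2 := by gcongr
      rw [mul_add] at h6
      nlinarith [sq_nonneg r]
    have h8 : (1 - b ^ 2 * r ^ 2) * (1 + r ^ 4) ≤ 1 := by
      have h9 : r ^ 2 ≤ 1 / 4 := by nlinarith
      have h10 : r ^ 2 * r ^ 2 ≤ r ^ 2 * (b ^ 2) := by gcongr; linarith
      nlinarith [mul_nonneg (mul_nonneg (sq_nonneg b) (sq_nonneg r)) (sq_nonneg (r ^ 2))]
    calc _ ≤ (1 + 4.15 * r ^ 2) * 1 := by gcongr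
      _ ≤ _ := by nlinarith [sq_nonneg (r ^ 2), sq_nonneg r]
  · have h1 := sqrt_two_mul_norm_scherkVertex_le s hx
    have h2 := sqrt_two_mul_norm_scherkMap_le s (u := u) (by linarith)
    have h3 : √2 * ‖scherkVertex s x - scherkMap s u‖ ≤ 2 * (1 + √2 * ‖s‖ + ‖s‖ ^ 2) := by
      have := mul_le_mul_of_nonneg_left (norm_sub_le (scherkVertex s x) (scherkMap s u))
        (Real.sqrt_nonneg 2)
      linarith
    rw [hsn] at h3
    have h4 : √2 * (b * r) ≤ 1.415 * (0.637 * r) := by gcongr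
    have h5 : (b * r) ^ 2 ≤ 0.406 * r ^ 2 := by rw [mul_pow]; gcongr
    have h6 : √2 * ‖scherkVertex s x - scherkMap s u‖ ≤ 2.902 + 1.715 * r ^ 2 := by
      have h7 : 0 ≤ (r - 1) ^ 2 := sq_nonneg _
      linarith
    have h7 : (1 - b ^ 2 * r ^ 2) * (1 + r ^ 4) ≤ (1 - 0.404 * r ^ 2) * (1 + r ^ 4) := by gcongr
    have hx1 : 1 / 4 ≤ r ^ 2 := by nlinarith
    have hx2 : r ^ 2 ≤ 1 := by nlinarith
    refine (mul_le_mul h6 h7 hP0 (by positivity)).trans ?_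
    have e : r ^ 4 = r ^ 2 * r ^ 2 := by ring
    rw [e]
    exact scherk_polynomial_bound hx1 hx2

end ScherkBounds

section Mobius

open Metric Set Filter Topology Complex
open scoped ComplexConjugate

/-- The disc automorphism sending `s` to the origin. -/
noncomputable def mobius (s v : ℂ) : ℂ := (v - s) / (1 - conj s * v)

lemma one_sub_conj_mul_ne_zero {s v : ℂ} (hs : ‖s‖ < 1) (hv : ‖v‖ ≤ 1) : 1 - conj s * v ≠ 0 := by
  refine sub_ne_zero.2 fun h => ?_
  have h1 : ‖conj s * v‖ = 1 := by rw [← h, norm_one]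
  rw [norm_mul, RCLike.norm_conj] at h1
  nlinarith [norm_nonneg s, norm_nonneg v]

lemma norm_mobius_lt {s v : ℂ} (hs : ‖s‖ < 1) (hv : ‖v‖ < 1) : ‖mobius s v‖ < 1 := by
  have h0 := one_sub_conj_mul_ne_zero hs hv.le
  rw [mobius, norm_div, div_lt_one (norm_pos_iff.2 h0)]
  refine lt_of_pow_lt_pow_left₀ 2 (norm_nonneg _) ?_
  have h1 : ‖s‖ ^ 2 < 1 := by nlinarith [norm_nonneg s]
  have h2 : ‖v‖ ^ 2 < 1 := by nlinarith [norm_nonneg v]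
  have h3 := mul_pos (sub_pos.2 h1) (sub_pos.2 h2)
  simp only [Complex.sq_norm, normSq_apply, sub_re, sub_im, mul_re, mul_im, one_re, one_im,
    conj_re, conj_im] at h3 ⊢
  nlinarith

lemma mobius_add_div {s v : ℂ} (hs : ‖s‖ < 1) (hv : ‖v‖ < 1) :
    (mobius s v + s) / (1 + conj s * mobius s v) = v := by
  have h0 := one_sub_conj_mul_ne_zero hs hv.le
  have h1 := one_sub_conj_mul_ne_zero hs hs.le
  have e1 : mobius s v + s = v * (1 - conj s * s) / (1 - conj s * v) := by
    rw [mobius, div_add' _ _ _ h0]; ring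
  have e2 : 1 + conj s * mobius s v = (1 - conj s * s) / (1 - conj s * v) := by
    rw [mobius, mul_div_assoc', add_div' _ _ _ h0]; ring
  rw [e1, e2, div_div_div_cancel_right₀ h0, mul_div_assoc, div_self h1, mul_one]

lemma mobius_mobius_neg {s v : ℂ} (hs : ‖s‖ < 1) (hv : ‖v‖ < 1) : mobius s (mobius (-s) v) = v := by
  have := mobius_add_div (s := -s) (by rwa [norm_neg]) hv
  rw [map_neg, neg_mul, ← sub_eq_add_neg, ← sub_eq_add_neg] at this
  exact this

lemma hasDerivAt_mobius {s v : ℂ} (h : 1 - conj s * v ≠ 0) :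
    HasDerivAt (mobius s) ((1 - conj s * s) / (1 - conj s * v) ^ 2) v := by
  have := ((hasDerivAt_id v).sub_const s).div (((hasDerivAt_id v).const_mul (conj s)).const_sub 1) h
  refine this.congr_deriv ?_
  simp only [id]
  congr 1; ring

end Mobius

section Comparison

open Metric Set Filter Topology Complex
open scoped ComplexConjugate

lemma exists_sum_arcMeasure_ofReal {l : ℝ} (h0 : 0 ≤ l) (h1 : l < 1) :
    ∃ θ : ℝ, 1 / 4 ≤ θ ∧ θ ≤ 1 / 2 ∧ ∀ V : ℂ → ℂ,
    ∑ k : Fin 4, arcMeasure (I ^ (k : ℕ)) l * V (I ^ (k : ℕ)) =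
      θ * (V 1 + V (-I)) + (1 / 2 - θ) * (V I + V (-1)) := by
  have hI : boundaryAngle (-I) l = - boundaryAngle I l := by
    have : 1 - (l : ℂ) * conj (-I) = conj (1 - l * conj I) := by simp [sub_eq_add_neg]
    rw [boundaryAngle, boundaryAngle, this, log_conj]
    · simp
    · rw [Ne, arg_eq_pi_iff]; simp
  have hpos : 0 ≤ boundaryAngle I l := by
    rw [boundaryAngle, log_im, arg_nonneg_iff]; simpa
  have hreal : ∀ y : ℝ, 0 < y → (Complex.log y).im = 0 := fun y hy => by
    rw [← ofReal_log hy.le, ofReal_im]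
  have hone : boundaryAngle 1 l = 0 := by
    rw [boundaryAngle, ← hreal (1 - l) (by linarith)]; simp
  have hneg : boundaryAngle (-1) l = 0 := by
    rw [boundaryAngle, ← hreal (1 + l) (by linarith)]; simp
  refine ⟨1 / 4 + boundaryAngle I l / π, by linarith [div_nonneg hpos pi_pos.le], ?_, fun V => ?_⟩
  · have h := arcMeasure_pos (x := I) (u := l) (by simp) (by simpa [abs_of_nonneg h0])
    rw [arcMeasure, I_mul_I, hneg, zero_sub, neg_div] at h
    linarith
  simp only [Fin.sum_univ_four, arcMeasure]
  simp [I_sq, I_pow_three, hone, hneg, hI]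
  ring

end Comparison

section Comparison

open Metric Set Filter Topology Complex
open scoped ComplexConjugate

lemma norm_mul_add_mul_lt {p q : ℝ} (hp : 0 < p) (hq : 0 < q) {x y : ℂ} (hx : ‖x‖ ≤ 1)
    (hy : ‖y‖ ≤ 1) (hxy : x ≠ y) : ‖(p : ℂ) * x + q * y‖ < p + q := by
  have hpq : 0 < p + q := by positivity
  have hpq' : (p + q : ℂ) ≠ 0 := by exact_mod_cast hpq.ne'
  have h := norm_combo_lt_of_ne hx hy hxy (div_pos hp hpq) (div_pos hq hpq) (by field_simp)
  have e : (p / (p + q)) • x + (q / (p + q)) • y = ((p + q : ℝ) : ℂ)⁻¹ * (p * x + q * y) := by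
    simp only [real_smul]; push_cast; field_simp
  rw [e, norm_mul, norm_inv, norm_real, Real.norm_eq_abs, abs_of_pos hpq,
    inv_mul_lt_iff₀ hpq, mul_one] at h
  exact h

lemma norm_sum_arcMeasure_mul_lt {V : ℂ → ℂ} (hV : ∀ x, ‖x‖ = 1 → ‖V x‖ ≤ 1) (hne : V 1 ≠ V (-I))
    {u : ℂ} (hu : ‖u‖ < 1) : ‖∑ k : Fin 4, arcMeasure (I ^ (k : ℕ)) u * V (I ^ (k : ℕ))‖ < 1 := by
  have hsum := sum_arcMeasure u
  have hpos : ∀ k : ℕ, 0 < arcMeasure (I ^ k) u := fun k => arcMeasure_pos (norm_I_pow k) hu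
  have hk : ∀ k : ℕ, ‖(arcMeasure (I ^ k) u : ℂ) * V (I ^ k)‖ ≤ arcMeasure (I ^ k) u := fun k => by
    rw [norm_mul, norm_real, Real.norm_eq_abs, abs_of_pos (hpos k)]
    exact mul_le_of_le_one_right (hpos k).le (hV _ (norm_I_pow k))
  have h3 : ((3 : Fin 4) : ℕ) = 3 := rfl
  have h03 := norm_mul_add_mul_lt (hpos 0) (hpos 3) (hV _ (norm_I_pow 0)) (hV _ (norm_I_pow 3))
    (by simpa [I_pow_three] using hne)
  simp only [Fin.sum_univ_four, Fin.val_zero, Fin.val_one, Fin.val_two, Fin.isValue, h3] at hsum ⊢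
  calc _ = ‖((arcMeasure (I ^ 0) u : ℂ) * V (I ^ 0) + arcMeasure (I ^ 3) u * V (I ^ 3)) +
        arcMeasure (I ^ 1) u * V (I ^ 1) + arcMeasure (I ^ 2) u * V (I ^ 2)‖ := by congr 1; ring
    _ ≤ _ := norm_add₃_le
    _ < 1 := by linarith [hk 1, hk 2]

lemma exists_norm_sum_arcMeasure_mul_le {V : ℂ → ℂ} (hV : ∀ x, ‖x‖ = 1 → ‖V x‖ ≤ 1)
    (hne : V 1 ≠ V (-I)) : ∃ R < 1, ∀ l : ℝ, 0 ≤ l → l < 1 →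
      ‖∑ k : Fin 4, arcMeasure (I ^ (k : ℕ)) l * V (I ^ (k : ℕ))‖ ≤ R := by
  have h := norm_mul_add_mul_lt one_pos one_pos (hV 1 (by simp)) (hV (-I) (by simp)) hne
  simp only [ofReal_one, one_mul] at h
  refine ⟨1 - (2 - ‖V 1 + V (-I)‖) / 4, by linarith, fun l h0 h1 => ?_⟩
  obtain ⟨θ, hθ, hθ2, e⟩ := exists_sum_arcMeasure_ofReal h0 h1
  rw [e]
  have h2 : ‖V I + V (-1)‖ ≤ 2 :=
    (norm_add_le _ _).trans (by linarith [hV I (by simp), hV (-1) (by simp)])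
  refine (norm_add_le _ _).trans ?_
  have e1 : (1 / 2 - θ : ℂ) = ((1 / 2 - θ : ℝ) : ℂ) := by push_cast; rfl
  rw [e1, norm_mul, norm_mul, norm_real, norm_real, Real.norm_eq_abs, Real.norm_eq_abs,
    abs_of_nonneg (by linarith), abs_of_nonneg (by linarith)]
  nlinarith

lemma mul_scherkMap_sub (A s c u : ℂ) : A * (scherkMap s u - c) =
    ∑ k : Fin 4, arcMeasure (I ^ (k : ℕ)) u * (A * (scherkVertex s (I ^ (k : ℕ)) - c)) := by
  have h : (∑ k : Fin 4, (arcMeasure (I ^ (k : ℕ)) u : ℂ)) = 1 := by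
    exact_mod_cast sum_arcMeasure u
  calc _ = A * (scherkMap s u - (∑ k : Fin 4, (arcMeasure (I ^ (k : ℕ)) u : ℂ)) * c) := by
        rw [h, one_mul]
    _ = _ := by
      rw [scherkMap, Finset.sum_mul, ← Finset.sum_sub_distrib, Finset.mul_sum]
      exact Finset.sum_congr rfl fun k _ => by ring

lemma scherkVertex_one_ne {A s c : ℂ} (hs : ‖s‖ < 1) (hA : A ≠ 0) :
    A * (scherkVertex s 1 - c) ≠ A * (scherkVertex s (-I) - c) := by
  intro h
  have h1 : scherkVertex s 1 - scherkVertex s (-I) = I * (1 + conj s) ^ 2 := by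
    simp only [scherkVertex, neg_pow I, I_sq, I_pow_three]
    linear_combination (-I / 2 - I * conj s ^ 2 / 2) * I_sq
  have h2 : scherkVertex s 1 - scherkVertex s (-I) = 0 := by
    linear_combination mul_left_cancel₀ hA h
  rw [h1] at h2
  have h3 : 1 + conj s ≠ 0 := by
    simpa using one_sub_conj_mul_ne_zero (s := -s) (v := 1) (by rwa [norm_neg]) (by simp)
  exact mul_ne_zero I_ne_zero (pow_ne_zero 2 h3) h2

/-- The comparison map does not cover the disc, so that it has no left inverse bounded by one. -/
lemma not_comp_scherkMap_eq {q : ℂ → ℂ} {A s c : ℂ} (hq : ContinuousOn q (ball 0 1))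
    (hq1 : ∀ z ∈ ball (0 : ℂ) 1, ‖q z‖ < 1) (hs : ‖s‖ < 1) (hA : A ≠ 0)
    (hV : ∀ x, ‖x‖ = 1 → ‖A * (scherkVertex s x - c)‖ ≤ 1)
    (h : ∀ v ∈ ball (0 : ℂ) 1, q (A * (scherkMap s (mobius s v) - c)) = v) : False := by
  have hns : ‖-s‖ < 1 := by rwa [norm_neg]
  obtain ⟨R, hR1, hR⟩ := exists_norm_sum_arcMeasure_mul_le hV (scherkVertex_one_ne hs hA)
  have hR0 : 0 ≤ R := (norm_nonneg _).trans (hR 0 le_rfl one_pos)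
  have hsub : closedBall (0 : ℂ) R ⊆ ball 0 1 := closedBall_subset_ball hR1
  obtain ⟨z, hz, hmax⟩ := (isCompact_closedBall (0 : ℂ) R).exists_isMaxOn
    ⟨0, by simpa using hR0⟩ (hq.mono hsub).norm
  have hle : ∀ l ∈ Ico (0 : ℝ) 1, ‖mobius (-s) l‖ ≤ ‖q z‖ := by
    intro l hl
    have hl1 : ‖(l : ℂ)‖ < 1 := by
      rw [norm_real, Real.norm_eq_abs, abs_of_nonneg hl.1]; exact hl.2
    have e := h _ (mem_ball_zero_iff.2 (norm_mobius_lt hns hl1))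
    rw [mobius_mobius_neg hs hl1] at e
    rw [← e]
    refine hmax (mem_closedBall_zero_iff.2 ?_)
    rw [mul_scherkMap_sub]
    exact hR l hl.1 hl.2
  have hne : 1 - conj (-s) * ((1 : ℝ) : ℂ) ≠ 0 := one_sub_conj_mul_ne_zero hns (by simp)
  have hcont : ContinuousWithinAt (fun l : ℝ => ‖mobius (-s) l‖) (Ico 0 1) 1 := by
    refine ContinuousAt.continuousWithinAt ?_
    exact ((hasDerivAt_mobius hne).continuousAt.comp continuous_ofReal.continuousAt).norm
  have h1 : ‖mobius (-s) (1 : ℝ)‖ ≤ ‖q z‖ := by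
    have hcl : (1 : ℝ) ∈ closure (Ico (0 : ℝ) 1) := by
      rw [closure_Ico zero_ne_one]; simp
    have := mem_closure_iff_nhdsWithin_neBot.1 hcl
    exact le_of_tendsto hcont (eventually_mem_nhdsWithin.mono hle)
  have h2 : ‖mobius (-s) (1 : ℝ)‖ = 1 := by
    rw [mobius, norm_div, div_eq_one_iff_eq (norm_pos_iff.2 hne).ne', ← RCLike.norm_conj]
    simp
  linarith [hq1 z (hsub hz)]

end Comparison

section Comparison

open Metric Set Filter Topology Complex
open scoped ComplexConjugate

/-- The derivative of `A (scherkMap s ∘ mobius s)`. -/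
noncomputable def scherkDeriv (A s v : ℂ) : ℂ :=
  A * (2 / π * (1 + conj s * mobius s v) ^ 2 / (1 - mobius s v ^ 4)) *
    ((1 - conj s * s) / (1 - conj s * v) ^ 2)

lemma one_sub_pow_four_ne_zero {v : ℂ} (hv : ‖v‖ < 1) : 1 - v ^ 4 ≠ 0 := by
  refine sub_ne_zero.2 fun h => ?_
  have h1 := pow_lt_one₀ (norm_nonneg v) hv four_ne_zero
  rw [← norm_pow, ← h, norm_one] at h1
  exact lt_irrefl _ h1

lemma one_add_conj_mul_ne_zero {s v : ℂ} (hs : ‖s‖ < 1) (hv : ‖v‖ ≤ 1) : 1 + conj s * v ≠ 0 := by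
  simpa using one_sub_conj_mul_ne_zero (s := -s) (by rwa [norm_neg]) hv

lemma hasFDerivAt_scherkMap_mobius (A : ℝ) {s v : ℂ} (c : ℂ) (hs : ‖s‖ < 1) (hv : ‖v‖ < 1) :
    HasFDerivAt (fun v => A * (scherkMap s (mobius s v) - c))
      (wirtinger (scherkDeriv A s v) (-conj (v ^ 2 * scherkDeriv A s v))) v := by
  have hm := norm_mobius_lt hs hv
  have h1 := hasFDerivAt_scherkMap s (one_add_conj_mul_ne_zero hs hm.le) hm
  have h2 := (hasDerivAt_mobius (one_sub_conj_mul_ne_zero hs hv.le)).hasFDerivAt.restrictScalars ℝ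
  have h3 := ((h1.comp v h2).sub_const c).const_mul (A : ℂ)
  refine h3.congr_fderiv ?_
  rw [mobius_add_div hs hv]
  ext w
  simp [scherkDeriv]
  ring

lemma continuousOn_scherkDeriv (A : ℂ) {s : ℂ} (hs : ‖s‖ < 1) :
    ContinuousOn (scherkDeriv A s) (ball 0 1) := by
  intro v hv
  rw [mem_ball_zero_iff] at hv
  have h0 := one_sub_conj_mul_ne_zero hs hv.le
  have hm := (hasDerivAt_mobius h0).continuousAt
  have h1 := one_sub_pow_four_ne_zero (norm_mobius_lt hs hv)
  refine ContinuousAt.continuousWithinAt ?_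
  have n1 : ContinuousAt (fun v => (2 / π : ℂ) * (1 + conj s * mobius s v) ^ 2) v :=
    continuousAt_const.mul ((continuousAt_const.add (continuousAt_const.mul hm)).pow 2)
  have n2 : ContinuousAt (fun v => 1 - mobius s v ^ 4) v := continuousAt_const.sub (hm.pow 4)
  have n3 : ContinuousAt (fun v => (1 - conj s * v) ^ 2) v :=
    (continuousAt_const.sub (continuousAt_const.mul continuousAt_id)).pow 2
  exact (continuousAt_const.mul (n1.div n2 h1)).mul (continuousAt_const.div n3 (pow_ne_zero 2 h0))

/-- A solution of the Beltrami equation in normalized position has small derivative. -/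
lemma norm_lt_of_normalized {q a : ℂ → ℂ} {u : ℂ} {b r κ : ℝ}
    (hq : ∀ z ∈ ball (0 : ℂ) 1, HasFDerivAt q (wirtinger (a z) (conj (q z) ^ 2 * a z)) z)
    (ha : ContinuousOn a (ball 0 1)) (hq1 : ∀ z ∈ ball (0 : ℂ) 1, ‖q z‖ < 1)
    (hb : b = 2 / π) (hr : ‖u‖ = r) (hr1 : r < 1) (hκ : 0 < κ)
    (hq0 : q 0 = ((1 + b) / (1 + b * r ^ 2) : ℝ) * u) (ha0 : a 0 = κ * (1 - u ^ 4)) :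
    2 * √2 * (‖a 0‖ * (1 - ‖q 0‖ ^ 2)) < π * (1 + ‖q 0‖ ^ 2) := by
  by_contra! hcurv
  have hr0 : 0 ≤ r := hr ▸ norm_nonneg u
  have hb0 : 0 < b := by rw [hb]; positivity
  have hb1 : b < 1 := by
    rw [hb, div_lt_one Real.pi_pos]; linarith [Real.pi_gt_three]
  have hu1 : ‖u‖ < 1 := hr ▸ hr1
  obtain ⟨s, hs⟩ : ∃ s : ℂ, s = b * u := ⟨_, rfl⟩
  have hsn : ‖s‖ = b * r := by rw [hs, norm_mul, norm_real, hr, Real.norm_eq_abs, abs_of_pos hb0]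
  have hs1 : ‖s‖ < 1 := by rw [hsn]; nlinarith
  have huu : conj u * u = (r ^ 2 : ℝ) := by rw [mul_comm, mul_conj, normSq_eq_norm_sq, hr]
  have hsu : conj s * u = (b * r ^ 2 : ℝ) := by
    rw [hs, map_mul, conj_ofReal, mul_assoc, huu]; push_cast; ring
  have hss : conj s * s = (b ^ 2 * r ^ 2 : ℝ) := by
    rw [mul_comm, mul_conj, normSq_eq_norm_sq, hsn]; push_cast; ring
  obtain ⟨E, hE⟩ : ∃ E : ℝ, E = 1 + b * r ^ 2 := ⟨_, rfl⟩
  have hE0 : 0 < E := by rw [hE]; positivity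
  obtain ⟨D, hD⟩ : ∃ D : ℝ, D = 1 - b ^ 2 * r ^ 2 := ⟨_, rfl⟩
  have hD0 : 0 < D := by
    rw [hD]; rw [hsn] at hs1; nlinarith [mul_nonneg hb0.le hr0]
  have hτ : q 0 = mobius (-s) u := by
    rw [hq0, mobius, map_neg, neg_mul, sub_neg_eq_add, sub_neg_eq_add, hsu, hs]
    push_cast; ring
  obtain ⟨t, ht⟩ : ∃ t : ℝ, t = ‖q 0‖ := ⟨_, rfl⟩
  have ht1 : t < 1 := ht ▸ hq1 0 (by simp)
  have ht0 : 0 ≤ t := ht ▸ norm_nonneg _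
  have htE : E * t = (1 + b) * r := by
    rw [ht, hq0, norm_mul, hr, norm_real, Real.norm_eq_abs, ← hE, abs_of_pos (by positivity)]
    field_simp
  rw [← ht] at hcurv
  have ht2 : t ^ 2 < 1 := by nlinarith
  have ht4 : 0 < 1 - t ^ 4 := sub_pos.2 (pow_lt_one₀ ht0 ht1 four_ne_zero)
  set A : ℝ := π * D / (2 * κ * E ^ 4 * (1 - t ^ 4)) with hA
  have hA0 : 0 < A := by positivity
  have hV : ∀ x : ℂ, ‖x‖ = 1 → ‖(A : ℂ) * (scherkVertex s x - scherkMap s u)‖ ≤ 1 := by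
    intro x hx
    have h1 := norm_scherkVertex_sub_scherkMap_le hb hr hr1 hs hx
    rw [← hD, ← hE, ← mul_pow, ← htE] at h1
    rw [norm_mul, norm_real, Real.norm_eq_abs, abs_of_pos hA0, hA, div_mul_eq_mul_div,
      div_le_one (by positivity)]
    generalize ‖scherkVertex s x - scherkMap s u‖ = N at h1
    have h2 : ‖a 0‖ ≤ κ * (1 + r ^ 4) := by
      rw [ha0, norm_mul, norm_real, Real.norm_eq_abs, abs_of_pos hκ]
      have := norm_sub_le (1 : ℂ) (u ^ 4)
      rw [norm_one, norm_pow, hr] at this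
      gcongr
    have h3 : π * (1 + t ^ 2) ≤ 2 * √2 * (κ * (1 + r ^ 4) * (1 - t ^ 2)) :=
      hcurv.trans (by gcongr)
    have h4 : 0 < √2 * (1 + r ^ 4) := by positivity
    refine le_of_mul_le_mul_right ?_ h4
    calc π * D * N * (√2 * (1 + r ^ 4)) = π * (√2 * N * (D * (1 + r ^ 4))) := by ring
      _ ≤ π * (E ^ 2 + (E * t) ^ 2) ^ 2 := by gcongr
      _ = E ^ 4 * (1 + t ^ 2) * (π * (1 + t ^ 2)) := by ring
      _ ≤ E ^ 4 * (1 + t ^ 2) * (2 * √2 * (κ * (1 + r ^ 4) * (1 - t ^ 2))) := by gcongr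
      _ = _ := by ring
  have hAc : (A : ℂ) ≠ 0 := by exact_mod_cast hA0.ne'
  have hmt : mobius s (q 0) = u := by rw [hτ, mobius_mobius_neg hs1 hu1]
  have hpos : ∀ v ∈ ball (0 : ℂ) 1, ‖(A : ℂ) * (scherkMap s (mobius s v) - scherkMap s u)‖ < 1 := by
    intro v hv
    rw [mul_scherkMap_sub]
    exact norm_sum_arcMeasure_mul_lt hV (scherkVertex_one_ne hs1 hAc)
      (norm_mobius_lt hs1 (mem_ball_zero_iff.1 hv))
  refine not_comp_scherkMap_eq (fun z hz => (hq z hz).continuousAt.continuousWithinAt) hq1 hs1 hAc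
    hV (comp_eq_self_of_tangent hq ha hq1 (fun v hv => hasFDerivAt_scherkMap_mobius A (scherkMap s u)
      hs1 (mem_ball_zero_iff.1 hv)) (continuousOn_scherkDeriv A hs1) hpos
      (t := q 0) (mem_ball_zero_iff.2 (hq1 0 (by simp))) (by rw [hmt]; simp) rfl ?_)
  have h1 : conj (q 0) ^ 2 * q 0 ^ 2 = (t ^ 4 : ℝ) := by
    rw [← mul_pow, mul_comm (conj _), mul_conj, normSq_eq_norm_sq, ← ht]; push_cast; ring
  have h2 : 1 - conj s * q 0 = D / E := by
    have hEc : (1 + (b * r ^ 2 : ℝ) : ℂ) ≠ 0 := by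
      rw [← hsu]; exact one_add_conj_mul_ne_zero hs1 hu1.le
    rw [hτ, mobius, map_neg, neg_mul, sub_neg_eq_add, sub_neg_eq_add, hsu, hE, hD, mul_div_assoc',
      mul_add, hsu, hss]
    push_cast at hEc ⊢
    field_simp
    ring
  rw [scherkDeriv, hmt, hsu, hss, h2, ha0, h1, hA]
  have hu4 := one_sub_pow_four_ne_zero hu1
  have e1 : (1 - (b ^ 2 * r ^ 2 : ℝ) : ℂ) = D := by rw [hD]; push_cast; rfl
  have e2 : (1 + (b * r ^ 2 : ℝ) : ℂ) = E := by rw [hE]; push_cast; rfl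
  have hDc : (D : ℂ) ≠ 0 := by exact_mod_cast hD0.ne'
  have hEc : (E : ℂ) ≠ 0 := by exact_mod_cast hE0.ne'
  have hκc : (κ : ℂ) ≠ 0 := by exact_mod_cast hκ.ne'
  have hπc : (π : ℂ) ≠ 0 := by exact_mod_cast Real.pi_ne_zero
  have ht4c : (1 - t ^ 4 : ℂ) ≠ 0 := by exact_mod_cast ht4.ne'
  rw [e1, e2]
  push_cast
  field_simp

end Comparison

section Rotation

open Metric Set Filter Topology Complex
open scoped ComplexConjugate

/-- Solutions of the Beltrami equation can be rotated. -/
lemma hasFDerivAt_rotate {q a : ℂ → ℂ} {l z : ℂ} (hl : ‖l‖ = 1)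
    (h : HasFDerivAt q (wirtinger (a (l * z)) (conj (q (l * z)) ^ 2 * a (l * z))) (l * z)) :
    HasFDerivAt (fun z => l * q (l * z))
      (wirtinger (l ^ 2 * a (l * z)) (conj (l * q (l * z)) ^ 2 * (l ^ 2 * a (l * z)))) z := by
  have hll : l * conj l = 1 := by rw [mul_conj, normSq_eq_norm_sq, hl]; norm_num
  have h1 := (h.comp z ((hasFDerivAt_id z).const_mul l)).const_mul l
  refine h1.congr_fderiv ?_
  ext w
  simp
  linear_combination -(conj (q (l * z)) ^ 2 * a (l * z) * conj w * (l * conj l)) * hll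

/-- The rotation bringing the derivative at the origin into normalized position. -/
lemma exists_rotation {a u : ℂ} (ha : a ≠ 0) (hu : ‖u‖ < 1) :
    ∃ (l : ℂ) (κ : ℝ), ‖l‖ = 1 ∧ 0 < κ ∧ l ^ 2 * a = κ * (1 - (l * u) ^ 4) := by
  have hd : (1 : ℂ) - u ^ 4 * conj (u ^ 4) ≠ 0 := by
    have h1 := one_sub_conj_mul_ne_zero (s := u ^ 4) (v := u ^ 4)
      (by rw [norm_pow]; exact pow_lt_one₀ (norm_nonneg u) hu four_ne_zero)
      (by rw [norm_pow]; exact pow_le_one₀ (norm_nonneg u) hu.le)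
    rwa [mul_comm] at h1
  have hd' : (1 : ℂ) - conj (u ^ 4) * u ^ 4 ≠ 0 := by rwa [mul_comm]
  obtain ⟨P, hP⟩ : ∃ P : ℂ, conj P - u ^ 4 * P = a := by
    refine ⟨(conj a + conj (u ^ 4) * a) / (1 - u ^ 4 * conj (u ^ 4)), ?_⟩
    simp only [map_div₀, map_add, map_sub, map_mul, map_one, conj_conj]
    rw [mul_comm (conj (u ^ 4)) (u ^ 4), ← mul_div_assoc, ← sub_div, div_eq_iff hd]
    ring
  have hP0 : P ≠ 0 := by rintro rfl; simp at hP; exact ha hP.symm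
  have hn : (‖P‖ : ℂ) ≠ 0 := by exact_mod_cast (norm_pos_iff.2 hP0).ne'
  obtain ⟨l, hl⟩ := IsAlgClosed.exists_pow_nat_eq (P / ‖P‖) two_pos
  have hl2 : ‖l‖ ^ 2 = 1 := by
    rw [← norm_pow, hl, norm_div, norm_real, norm_norm, div_self (norm_pos_iff.2 hP0).ne']
  refine ⟨l, ‖P‖, (pow_eq_one_iff_of_nonneg (norm_nonneg l) two_ne_zero).1 hl2,
    norm_pos_iff.2 hP0, ?_⟩
  have hPP : P * conj P = ‖P‖ * ‖P‖ := by rw [mul_conj, normSq_eq_norm_sq]; push_cast; ring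
  have e : (l * u) ^ 4 = (l ^ 2) ^ 2 * u ^ 4 := by ring
  rw [e, hl, ← hP]
  field_simp
  linear_combination hPP

/-- The sharp form of the bound for solutions of the Beltrami equation. -/
theorem norm_lt_of_beltrami {q a : ℂ → ℂ}
    (hq : ∀ z ∈ ball (0 : ℂ) 1, HasFDerivAt q (wirtinger (a z) (conj (q z) ^ 2 * a z)) z)
    (ha : ContinuousOn a (ball 0 1)) (hq1 : ∀ z, ‖q z‖ < 1) :
    2 * √2 * (‖a 0‖ * (1 - ‖q 0‖ ^ 2)) < π * (1 + ‖q 0‖ ^ 2) := by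
  rcases eq_or_ne (a 0) 0 with h0 | h0
  · rw [h0]; simp; positivity
  obtain ⟨b, hb⟩ : ∃ b : ℝ, b = 2 / π := ⟨_, rfl⟩
  have hb0 : 0 < b := by rw [hb]; positivity
  have hpos : ∀ r : ℝ, 0 < 1 + b * r ^ 2 := fun r => by positivity
  obtain ⟨r, hr, hrq⟩ : ∃ r ∈ Icc (0 : ℝ) 1, (1 + b) * r / (1 + b * r ^ 2) = ‖q 0‖ := by
    refine intermediate_value_Icc zero_le_one (f := fun r : ℝ => (1 + b) * r / (1 + b * r ^ 2))
      (fun r _ => ContinuousAt.continuousWithinAt ?_) ⟨by simp, ?_⟩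
    · exact ContinuousAt.div (by fun_prop) (by fun_prop) (hpos r).ne'
    · have : (1 + b) * 1 / (1 + b * 1 ^ 2) = 1 := by
        rw [one_pow, mul_one, mul_one, div_self (by positivity : 1 + b ≠ 0)]
      rw [this]; exact (hq1 0).le
  have hr1 : r < 1 := by
    refine lt_of_le_of_ne hr.2 ?_
    rintro rfl
    have := hq1 0
    rw [← hrq] at this
    simp [div_self (by positivity : 1 + b ≠ 0)] at this
  obtain ⟨u, hu⟩ : ∃ u : ℂ, u = ((1 + b * r ^ 2) / (1 + b) : ℝ) * q 0 := ⟨_, rfl⟩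
  have hur : ‖u‖ = r := by
    have := (hpos r).ne'
    rw [hu, norm_mul, norm_real, Real.norm_eq_abs, abs_of_pos (by positivity), ← hrq]
    field_simp
  obtain ⟨l, κ, hl, hκ, hlκ⟩ := exists_rotation h0 (hur ▸ hr1)
  have hmem : ∀ z ∈ ball (0 : ℂ) 1, l * z ∈ ball (0 : ℂ) 1 := fun z hz => by
    simpa [hl] using hz
  have h := norm_lt_of_normalized (q := fun z => l * q (l * z)) (a := fun z => l ^ 2 * a (l * z))
    (u := l * u) (b := b) (r := r) (κ := κ) (fun z hz => hasFDerivAt_rotate hl (hq _ (hmem z hz)))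
    (continuousOn_const.mul (ha.comp (by fun_prop) hmem)) (fun z _ => by simpa [hl] using hq1 _)
    hb (by simp [hl, hur]) hr1 hκ ?_ (by simpa using hlκ)
  · simpa [hl] using h
  · rw [hu]
    have h1 : (((1 + b) / (1 + b * r ^ 2) : ℝ) : ℂ) * ((1 + b * r ^ 2) / (1 + b) : ℝ) = 1 := by
      rw [← ofReal_mul, div_mul_div_cancel₀ (hpos r).ne', div_self (by positivity), ofReal_one]
    rw [mul_zero]
    linear_combination -l * q 0 * h1

end Rotation

/-- For any minimal graph over the unit disk, the Gaussian
curvature at the point above the origin satisfies `|K| < π²/2`. -/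
theorem heinz_constant_bound (f : ℝ × ℝ → ℝ) (hf : IsMinimalGraph f) :
    |pu (pu f) ((0 : ℝ), (0 : ℝ)) * pv (pv f) ((0 : ℝ), (0 : ℝ))
        - (pv (pu f) ((0 : ℝ), (0 : ℝ))) ^ 2|
      / (1 + (pu f ((0 : ℝ), (0 : ℝ))) ^ 2 + (pv f ((0 : ℝ), (0 : ℝ))) ^ 2) ^ 2
    < π ^ 2 / 2 := by
  obtain ⟨q, a, hq, ha, hq1, hK⟩ := hf.exists_beltrami
  have h := norm_lt_of_beltrami hq ha hq1
  rw [hK]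
  have h2 : √2 ^ 2 = 2 := Real.sq_sqrt (by norm_num)
  have ht : ‖q 0‖ ^ 2 < 1 := pow_lt_one₀ (norm_nonneg _) (hq1 0) two_ne_zero
  have h0 : 0 ≤ 2 * √2 * (‖a 0‖ * (1 - ‖q 0‖ ^ 2)) := by
    have : 0 ≤ 1 - ‖q 0‖ ^ 2 := by linarith
    positivity
  have h3 := pow_lt_pow_left₀ h h0 two_ne_zero
  rw [div_pow, ← mul_div_assoc, div_lt_iff₀ (by positivity)]
  linear_combination h3 / 2 + (-2 * ‖a 0‖ ^ 2 * (1 - ‖q 0‖ ^ 2) ^ 2) * h2
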